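/- arXiv:2507.22552 — 3 statements merged into one kernel-verified Lean document; each statement's English description precedes it below -/
import Mathlib

section
/- Assume (h1), (h2) and (f1)–(f4). If u₀ belongs to the Nehari set M and satisfies J̃(u₀) = inf_{u∈M} J̃(u), then u₀ is a critical point of J̃: ⟨J̃′(u₀),φ⟩ = 0 for every finitely supported φ : ℤ^d → ℝ. -/
open MeasureTheory Filter Topology
open scoped ENNReal

noncomputable section

namespace DiscreteChoquard

variable {d : ℕ}

/-- The lattice `ℤ^d`. -/
abbrev Z (d : ℕ) := Fin d → ℤ

/-- Graph distance on `ℤ^d`, as a real number. -/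
def latDist (x y : Z d) : ℝ := ∑ i, |((x i - y i : ℤ) : ℝ)|

/-- The kernel hypotheses on `W_s`: symmetry, positivity, and the two-sided bound
`c|x−y|^{−d−2s} ≤ W_s(x,y) ≤ C|x−y|^{−d−2s}` for `x ≠ y`. -/
def KernelOK (d : ℕ) (s : ℝ) (W : Z d → Z d → ℝ) : Prop :=
  (∀ x y, W x y = W y x) ∧ (∀ x y, 0 < W x y) ∧
  ∃ c C : ℝ, 0 < c ∧ c ≤ C ∧ ∀ x y : Z d, x ≠ y →
    c * latDist x y ^ (-(d : ℝ) - 2 * s) ≤ W x y ∧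
      W x y ≤ C * latDist x y ^ (-(d : ℝ) - 2 * s)

/-- The fractional gradient form `∇^s u ∇^s v (x)`.  (The `y = x` summand vanishes, so we
sum over all `y`.) -/
def gradForm (W : Z d → Z d → ℝ) (u v : Z d → ℝ) (x : Z d) : ℝ :=
  (1 / 2) * ∑' y : Z d, W x y * (u x - u y) * (v x - v y)

/-- `|∇^s u|(x)`. -/
def gradNorm (W : Z d → Z d → ℝ) (u : Z d → ℝ) (x : Z d) : ℝ :=
  Real.sqrt ((1 / 2) * ∑' y : Z d, W x y * (u x - u y) ^ 2)

/-- The fractional `p`-Laplacian `(−Δ)_p^s u (x)`. -/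
def pLap (W : Z d → Z d → ℝ) (p : ℝ) (u : Z d → ℝ) (x : Z d) : ℝ :=
  (1 / 2) * ∑' y : Z d,
    W x y * (gradNorm W u x ^ (p - 2) + gradNorm W u y ^ (p - 2)) * (u x - u y)

/-- `‖u‖_{H_{s,p}}^p = ∑_x (|∇^s u|^p(x) + h(x)|u(x)|^p)`. -/
def HnormP (W : Z d → Z d → ℝ) (h : Z d → ℝ) (p : ℝ) (u : Z d → ℝ) : ℝ :=
  ∑' x : Z d, (gradNorm W u x ^ p + h x * |u x| ^ p)

/-- `‖u‖_{H_{s,p}}`. -/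
def normH (W : Z d → Z d → ℝ) (h : Z d → ℝ) (p : ℝ) (u : Z d → ℝ) : ℝ :=
  HnormP W h p u ^ (1 / p)

/-- Membership `u ∈ H_{s,p}`, i.e. `‖u‖_{H_{s,p}} < ∞` (all the defining series converge). -/
def memH (W : Z d → Z d → ℝ) (h : Z d → ℝ) (p : ℝ) (u : Z d → ℝ) : Prop :=
  (∀ x : Z d, Summable fun y : Z d => W x y * (u x - u y) ^ 2) ∧
  Summable fun x : Z d => gradNorm W u x ^ p + h x * |u x| ^ p

/-- The `ℓ^q` norm on `ℤ^d`. -/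
def lnorm (q : ℝ) (u : Z d → ℝ) : ℝ := (∑' x : Z d, |u x| ^ q) ^ (1 / q)

/-- The torus box `[0, 2π]^d`. -/
def box (d : ℕ) : Set (Fin d → ℝ) := Set.univ.pi fun _ => Set.Icc 0 (2 * Real.pi)

/-- `μ(k) = 2d − 2 ∑_j cos k_j`. -/
def muk (d : ℕ) (k : Fin d → ℝ) : ℝ := 2 * d - 2 * ∑ j, Real.cos (k j)

/-- The fractional degree `K_α = (2π)^{-d} ∫_{[0,2π]^d} μ(k)^{α/2} dk`. -/
def Kfrac (d : ℕ) (α : ℝ) : ℝ :=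
  (2 * Real.pi) ^ (-(d : ℝ)) * ∫ k in box d, muk d k ^ (α / 2)

/-- The Green's function `R_α(x,y)` of the discrete fractional Laplacian. -/
def Riesz (d : ℕ) (α : ℝ) (x y : Z d) : ℝ :=
  Kfrac d α * (2 * Real.pi) ^ (-(d : ℝ)) *
    ∫ k in box d, Real.cos (∑ j, ((x j - y j : ℤ) : ℝ) * k j) * muk d k ^ (-(α / 2))

/-- The convolution `(R_α ∗ v)(x) = ∑_y R_α(x,y) v(y)`. -/
def conv (d : ℕ) (α : ℝ) (v : Z d → ℝ) (x : Z d) : ℝ := ∑' y : Z d, Riesz d α x y * v y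

/-- `F(t) = ∫_0^t f(r) dr`. -/
def Fint (f : ℝ → ℝ) (t : ℝ) : ℝ := ∫ r in (0 : ℝ)..t, f r

/-- Positive part `u⁺ = max(u,0)`. -/
def pos (u : Z d → ℝ) (x : Z d) : ℝ := max (u x) 0

/-- Negative part `u⁻ = min(u,0)`. -/
def negp (u : Z d → ℝ) (x : Z d) : ℝ := min (u x) 0

/-- Hypothesis (h2): `h(x) → ∞` as `|x| → ∞`. -/
def H2 (h : Z d → ℝ) : Prop := Tendsto h cofinite atTop

/-- Hypothesis (f1): `f(t) = o(t^{p−1})` as `t → 0⁺`. -/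
def F1 (f : ℝ → ℝ) (p : ℝ) : Prop :=
  ∀ ε > (0 : ℝ), ∃ δ > (0 : ℝ), ∀ t : ℝ, 0 < t → t < δ → |f t| ≤ ε * t ^ (p - 1)

/-- Hypothesis (f3): `0 ≤ θ F(t) ≤ 2 f(t) t` for `t > 0`. -/
def F3 (f : ℝ → ℝ) (θ : ℝ) : Prop :=
  ∀ t > (0 : ℝ), 0 ≤ θ * Fint f t ∧ θ * Fint f t ≤ 2 * f t * t

/-- The energy functional `J̃`. -/
def energy (W : Z d → Z d → ℝ) (h : Z d → ℝ) (p α : ℝ) (f : ℝ → ℝ) (u : Z d → ℝ) : ℝ :=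
  (1 / p) * HnormP W h p u -
    (1 / 2) * ∑' x : Z d, conv d α (fun y => Fint f (pos u y)) x * Fint f (pos u x)

/-- The Nehari set `M`. -/
def Nehari (W : Z d → Z d → ℝ) (h : Z d → ℝ) (p α : ℝ) (f : ℝ → ℝ) : Set (Z d → ℝ) :=
  {u | memH W h p u ∧ u ≠ 0 ∧
    HnormP W h p u =
      ∑' x : Z d, conv d α (fun y => Fint f (pos u y)) x * f (pos u x) * pos u x}

/-- Hypothesis (f4). -/
def F4 (W : Z d → Z d → ℝ) (h : Z d → ℝ) (p α : ℝ) (f : ℝ → ℝ) : Prop :=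
  ∀ u : Z d → ℝ, memH W h p u → pos u ≠ 0 →
    StrictMonoOn (fun t : ℝ =>
      t ^ (1 - p) *
        ∑' x : Z d, conv d α (fun y => Fint f (t * pos u y)) x * f (t * pos u x) * pos u x)
      (Set.Ioi 0)

/-- The derivative pairing `⟨J̃′(u), φ⟩`. -/
def pairing (W : Z d → Z d → ℝ) (h : Z d → ℝ) (p α : ℝ) (f : ℝ → ℝ) (u φ : Z d → ℝ) : ℝ :=
  (∑' x : Z d,
      (gradNorm W u x ^ (p - 2) * gradForm W u φ x + h x * |u x| ^ (p - 2) * u x * φ x)) -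
    ∑' x : Z d, conv d α (fun y => Fint f (pos u y)) x * f (pos u x) * φ x

/-! ### Summability of the kernel -/

lemma summable_kernel {s : ℝ} (hs : 0 < s) {W : Z d → Z d → ℝ} (hW : KernelOK d s W) (x : Z d) :
    Summable fun y => W x y := by
  obtain ⟨-, hpos, c, C, hc, hcC, hb⟩ := hW
  let b := Pi.basisFun ℝ (Fin d)
  let L : Submodule ℤ (Fin d → ℝ) := Submodule.span ℤ (Set.range b)
  have hmem : ∀ n : Z d, (fun i => (n i : ℝ)) ∈ L := by
    intro n
    have : (fun i => (n i : ℝ)) = ∑ i, n i • b i := by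
      ext j
      simp [b, Pi.single_apply]
    rw [this]
    exact Submodule.sum_mem _ fun i _ => Submodule.smul_mem _ _ (Submodule.subset_span ⟨i, rfl⟩)
  have hfr : Module.finrank ℤ L = d := by
    rw [ZLattice.rank ℝ L]; simp
  have hsum := ZLattice.summable_norm_sub_rpow L (-(d : ℝ) - 2 * s)
    (by rw [hfr]; linarith) (fun i => (x i : ℝ))
  have hinj : Function.Injective (fun n : Z d => (⟨fun i => (n i : ℝ), hmem n⟩ : L)) := by
    intro m n hmn
    have := congrArg (fun z : L => (z : Fin d → ℝ)) hmn
    ext i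
    have := congrFun this i
    simpa using this
  have hsum2 := (hsum.comp_injective hinj).mul_left C
  refine Summable.of_norm_bounded_eventually hsum2 ?_
  have : ({x} : Set (Z d)).Finite := Set.finite_singleton x
  filter_upwards [this.compl_mem_cofinite] with y hy
  have hxy : x ≠ y := fun h => hy (by simp [h])
  rw [Real.norm_of_nonneg (hpos x y).le]
  refine (hb x y hxy).2.trans (mul_le_mul_of_nonneg_left ?_ (hc.le.trans hcC))
  have h1 : ‖(fun i => (y i : ℝ)) - (fun i => (x i : ℝ))‖ ≤ latDist x y := by
    have h0 : ∀ i, |((x i - y i : ℤ) : ℝ)| ≤ latDist x y := fun i =>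
      Finset.single_le_sum (f := fun i => |((x i - y i : ℤ) : ℝ)|)
        (fun j _ => abs_nonneg _) (Finset.mem_univ i)
    refine (pi_norm_le_iff_of_nonneg ?_).2 fun i => ?_
    · exact Finset.sum_nonneg fun j _ => abs_nonneg _
    · have := h0 i
      rw [Pi.sub_apply, Real.norm_eq_abs, abs_sub_comm]
      push_cast at this
      exact this
  have h2 : 0 < ‖(fun i => (y i : ℝ)) - (fun i => (x i : ℝ))‖ := by
    rw [norm_pos_iff, sub_ne_zero]
    intro h
    apply hxy
    ext i
    have := congrFun h i
    exact_mod_cast this.symm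
  have := Real.rpow_le_rpow_of_nonpos h2 h1
    (show -(d : ℝ) - 2 * s ≤ 0 by have : (0:ℝ) ≤ d := Nat.cast_nonneg d; linarith)
  exact this

/-! ### The Riesz kernel is bounded and symmetric -/

lemma riesz_symm (α : ℝ) (x y : Z d) : Riesz d α x y = Riesz d α y x := by
  unfold Riesz
  congr 2
  ext k
  congr 1
  rw [← Real.cos_neg]
  congr 1
  rw [← Finset.sum_neg_distrib]
  refine Finset.sum_congr rfl fun j _ => ?_
  push_cast
  ring

lemma integrable_one_dim {β : ℝ} (hβ0 : 0 < β) (hβ : β < 1) :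
    IntegrableOn (fun k : ℝ => (2 - 2 * Real.cos k) ^ (-(β / 2))) (Set.Ioo 0 (2 * Real.pi)) := by
  have hpi := Real.pi_pos
  have h1 : IntegrableOn (fun k : ℝ => k ^ (-β)) (Set.Ioo 0 (2 * Real.pi)) := by
    have := intervalIntegral.intervalIntegrable_rpow' (a := 0) (b := 2 * Real.pi)
      (r := -β) (by linarith)
    rwa [intervalIntegrable_iff_integrableOn_Ioo_of_le (by positivity)] at this
  have h2 : IntegrableOn (fun k : ℝ => (2 * Real.pi - k) ^ (-β)) (Set.Ioo 0 (2 * Real.pi)) := by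
    have := (intervalIntegral.intervalIntegrable_rpow' (a := 2 * Real.pi) (b := 0)
      (r := -β) (by linarith)).comp_sub_left (2 * Real.pi)
    simp only [sub_self, sub_zero] at this
    rwa [intervalIntegrable_iff_integrableOn_Ioo_of_le (by positivity)] at this
  have key : ∀ k : ℝ, 0 < k → k ≤ Real.pi →
      (2 - 2 * Real.cos k) ^ (-(β / 2)) ≤ (4 / Real.pi ^ 2) ^ (-(β / 2)) * k ^ (-β) := by
    intro k hk hkpi
    have hc := Real.cos_le_one_sub_mul_cos_sq (x := k) (by rw [abs_of_pos hk]; exact hkpi)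
    have hle : 4 / Real.pi ^ 2 * k ^ 2 ≤ 2 - 2 * Real.cos k := by
      have : 4 / Real.pi ^ 2 * k ^ 2 = 2 * (2 / Real.pi ^ 2 * k ^ 2) := by ring
      rw [this]; linarith
    have := Real.rpow_le_rpow_of_nonpos (by positivity) hle (show -(β / 2) ≤ 0 by linarith)
    refine this.trans (le_of_eq ?_)
    rw [Real.mul_rpow (by positivity) (by positivity), ← Real.rpow_natCast k 2,
      ← Real.rpow_mul hk.le]
    congr 2
    push_cast
    ring
  have hdom := (h1.add h2).const_mul ((4 / Real.pi ^ 2) ^ (-(β / 2)))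
  refine Integrable.mono' hdom ?_ ?_
  · exact (by fun_prop : Measurable fun k : ℝ => (2 - 2 * Real.cos k) ^ (-(β / 2))).aestronglyMeasurable
  · refine (ae_restrict_iff' measurableSet_Ioo).2 (Eventually.of_forall fun k hk => ?_)
    have hz : 0 ≤ 2 - 2 * Real.cos k := by linarith [Real.cos_le_one k]
    rw [Real.norm_of_nonneg (Real.rpow_nonneg hz _)]
    have hA : 0 ≤ (4 / Real.pi ^ 2 : ℝ) ^ (-(β / 2)) := by positivity
    have hB : 0 ≤ k ^ (-β) := Real.rpow_nonneg hk.1.le _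
    have hC : 0 ≤ (2 * Real.pi - k) ^ (-β) := Real.rpow_nonneg (by linarith [hk.2]) _
    simp only [Pi.add_apply, mul_add]
    rcases le_total k Real.pi with h | h
    · have := key k hk.1 h
      nlinarith [mul_nonneg hA hC]
    · have := key (2 * Real.pi - k) (by linarith [hk.2]) (by linarith)
      rw [Real.cos_two_pi_sub] at this
      nlinarith [mul_nonneg hA hB]

lemma integrable_muk (hd : 0 < d) {α : ℝ} (hα : α ∈ Set.Ioo (0 : ℝ) (d : ℝ)) :
    IntegrableOn (fun k => muk d k ^ (-(α / 2))) (box d) := by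
  have hd' : (0 : ℝ) < d := Nat.cast_pos.2 hd
  have hd1 : (1 : ℝ) ≤ d := by exact_mod_cast hd
  have hae : (Set.univ.pi fun _ : Fin d => Set.Ioo (0 : ℝ) (2 * Real.pi)) =ᵐ[volume] box d := by
    have := Measure.univ_pi_Ioo_ae_eq_Icc (μ := fun _ : Fin d => (volume : Measure ℝ))
      (f := fun _ => 0) (g := fun _ => 2 * Real.pi)
    have h2 : box d = Set.Icc (fun _ => 0) (fun _ => 2 * Real.pi) := by
      rw [← Set.pi_univ_Icc]; rfl
    rw [h2]
    exact this
  rw [← integrableOn_congr_set_ae hae]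
  have hdom : IntegrableOn (fun k : Fin d → ℝ => ∏ j, (2 - 2 * Real.cos (k j)) ^ (-(α / d / 2)))
      (Set.univ.pi fun _ : Fin d => Set.Ioo (0 : ℝ) (2 * Real.pi)) := by
    unfold IntegrableOn
    rw [volume_pi, Measure.restrict_pi_pi]
    exact Integrable.fintype_prod (f := fun (_ : Fin d) (k : ℝ) =>
      (2 - 2 * Real.cos k) ^ (-(α / d / 2)))
      fun j => integrable_one_dim (div_pos hα.1 hd') ((div_lt_one hd').2 hα.2)
  refine Integrable.mono' hdom ?_ ?_
  · have : Measurable fun k => muk d k ^ (-(α / 2)) := by unfold muk; fun_prop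
    exact this.aestronglyMeasurable
  · refine (ae_restrict_iff' (MeasurableSet.univ_pi fun _ => measurableSet_Ioo)).2
      (Eventually.of_forall fun k hk => ?_)
    have hz : ∀ j, 0 < 2 - 2 * Real.cos (k j) := by
      intro j
      have h1 := hk j (Set.mem_univ j)
      have : Real.cos (k j) ≠ 1 := by
        intro hc
        rw [Real.cos_eq_one_iff_of_lt_of_lt (by linarith [h1.1, Real.pi_pos]) h1.2] at hc
        exact h1.1.ne' hc
      have := lt_of_le_of_ne (Real.cos_le_one (k j)) this
      linarith
    have hmu : muk d k = ∑ j, (2 - 2 * Real.cos (k j)) := by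
      unfold muk
      rw [Finset.sum_sub_distrib, ← Finset.mul_sum]
      simp [mul_comm]
    have hmu0 : 0 ≤ muk d k := by rw [hmu]; exact Finset.sum_nonneg fun j _ => (hz j).le
    have hamgm := Real.geom_mean_le_arith_mean_weighted Finset.univ (fun _ : Fin d => (1 / d : ℝ))
      (fun j => 2 - 2 * Real.cos (k j)) (fun _ _ => by positivity)
      (by simp; field_simp) (fun j _ => (hz j).le)
    rw [← Finset.mul_sum, ← hmu] at hamgm
    have hle : ∏ j, (2 - 2 * Real.cos (k j)) ^ (1 / d : ℝ) ≤ muk d k := by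
      refine hamgm.trans ?_
      rw [div_mul_eq_mul_div, one_mul]
      exact div_le_self hmu0 hd1
    rw [Real.norm_of_nonneg (Real.rpow_nonneg hmu0 _)]
    have h3 := Real.rpow_le_rpow_of_nonpos
      (Finset.prod_pos fun j _ => Real.rpow_pos_of_pos (hz j) (1 / d : ℝ)) hle
      (show -(α / 2) ≤ 0 by linarith [hα.1])
    refine h3.trans (le_of_eq ?_)
    rw [← Real.finsetProd_rpow _ _ (fun j _ => Real.rpow_nonneg (hz j).le _)]
    refine Finset.prod_congr rfl fun j _ => ?_
    rw [← Real.rpow_mul (hz j).le]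
    congr 1
    field_simp

lemma riesz_bound (hd : 0 < d) {α : ℝ} (hα : α ∈ Set.Ioo (0 : ℝ) (d : ℝ)) :
    ∃ B : ℝ, 0 ≤ B ∧ ∀ x y : Z d, |Riesz d α x y| ≤ B := by
  have hint := (integrable_muk hd hα).norm
  refine ⟨|Kfrac d α * (2 * Real.pi) ^ (-(d : ℝ))| * ∫ k in box d, ‖muk d k ^ (-(α / 2))‖, ?_, ?_⟩
  · exact mul_nonneg (abs_nonneg _) (integral_nonneg fun _ => norm_nonneg _)
  · intro x y
    unfold Riesz
    rw [abs_mul]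
    refine mul_le_mul_of_nonneg_left ?_ (abs_nonneg _)
    rw [← Real.norm_eq_abs]
    refine norm_integral_le_of_norm_le hint (Eventually.of_forall fun k => ?_)
    rw [norm_mul]
    refine mul_le_of_le_one_left (norm_nonneg _) ?_
    rw [Real.norm_eq_abs]
    exact Real.abs_cos_le_one _

/-! ### The nonlinear term -/

lemma f_max {f : ℝ → ℝ} (hfz : ∀ t ≤ (0 : ℝ), f t = 0) (t : ℝ) : f (max t 0) = f t := by
  rcases le_total t 0 with h | h
  · rw [max_eq_right h, hfz t h, hfz 0 le_rfl]
  · rw [max_eq_left h]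

lemma Fint_max {f : ℝ → ℝ} (hfz : ∀ t ≤ (0 : ℝ), f t = 0) (t : ℝ) :
    Fint f (max t 0) = Fint f t := by
  rcases le_total t 0 with h | h
  · rw [max_eq_right h]
    unfold Fint
    rw [intervalIntegral.integral_same, intervalIntegral.integral_congr (g := fun _ => 0)]
    · simp
    · intro r hr
      rw [Set.uIcc_of_ge h] at hr
      exact hfz r hr.2
  · rw [max_eq_left h]

lemma f_mul_max {f : ℝ → ℝ} (hfz : ∀ t ≤ (0 : ℝ), f t = 0) (t : ℝ) :
    f t * max t 0 = f t * t := by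
  rcases le_total t 0 with h | h
  · rw [hfz t h]; simp
  · rw [max_eq_left h]

lemma Fint_hasDerivAt {f : ℝ → ℝ} (hfc : Continuous f) (t : ℝ) : HasDerivAt (Fint f) (f t) t :=
  intervalIntegral.integral_hasDerivAt_right (hfc.intervalIntegrable _ _)
    (hfc.stronglyMeasurableAtFilter _ _) hfc.continuousAt

lemma f_bound {f : ℝ → ℝ} (hfc : Continuous f) (hfz : ∀ t ≤ (0 : ℝ), f t = 0) {p : ℝ}
    (hp : 2 ≤ p) (hf1 : F1 f p) (M : ℝ) :
    ∃ C : ℝ, 0 ≤ C ∧ ∀ t, |t| ≤ M → |f t| ≤ C * |t| ^ (p - 1) := by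
  obtain ⟨δ, hδ, hδf⟩ := hf1 1 one_pos
  obtain ⟨B, hB⟩ := (isCompact_Icc (a := -M) (b := M)).exists_bound_of_continuousOn
    hfc.continuousOn
  have hd0 : 0 < δ ^ (p - 1) := Real.rpow_pos_of_pos hδ _
  refine ⟨1 + |B| / δ ^ (p - 1), by positivity, fun t ht => ?_⟩
  have hq : 0 ≤ |B| / δ ^ (p - 1) := by positivity
  rcases le_or_gt t 0 with h | h
  · rw [hfz t h, abs_zero]; positivity
  have htp : 0 ≤ |t| ^ (p - 1) := by positivity
  rcases lt_or_ge t δ with h2 | h2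
  · have := hδf t h h2
    rw [abs_of_pos h] at htp ⊢
    nlinarith [mul_nonneg hq htp]
  · have h3 : |f t| ≤ |B| := (hB t (abs_le.1 ht)).trans (le_abs_self B)
    rw [abs_of_pos h] at htp ⊢
    have h4 : δ ^ (p - 1) ≤ t ^ (p - 1) := Real.rpow_le_rpow hδ.le h2 (by linarith)
    have h5 : |B| ≤ |B| / δ ^ (p - 1) * t ^ (p - 1) := by
      rw [div_mul_eq_mul_div, le_div_iff₀ hd0]
      exact mul_le_mul_of_nonneg_left h4 (abs_nonneg _)
    nlinarith

lemma nl_bounds {f : ℝ → ℝ} (hfc : Continuous f) (hfz : ∀ t ≤ (0 : ℝ), f t = 0) {p : ℝ}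
    (hp : 2 ≤ p) (hf1 : F1 f p) {V : Z d → ℝ} (hV0 : ∀ x, 0 ≤ V x)
    (hV : Summable fun x => V x ^ p) :
    ∃ G : Z d → ℝ, Summable G ∧ (∀ x, 0 ≤ G x) ∧ ∀ x a b, |a| ≤ V x → |b| ≤ V x →
      |Fint f a| ≤ G x ∧ |f a * b| ≤ G x := by
  have hp0 : 0 < p := by linarith
  have hVM : ∀ x, V x ≤ (∑' x, V x ^ p) ^ (1 / p) := by
    intro x
    have h1 : V x ^ p ≤ ∑' x, V x ^ p :=
      hV.le_tsum x fun y _ => Real.rpow_nonneg (hV0 y) _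
    have h2 := Real.rpow_le_rpow (Real.rpow_nonneg (hV0 x) _) h1 (show 0 ≤ 1 / p by positivity)
    rwa [← Real.rpow_mul (hV0 x), mul_one_div_cancel hp0.ne', Real.rpow_one] at h2
  obtain ⟨C, hC, hCf⟩ := f_bound hfc hfz hp hf1 ((∑' x, V x ^ p) ^ (1 / p))
  have hpow : ∀ x, C * V x ^ (p - 1) * V x = C * V x ^ p := by
    intro x
    rw [mul_assoc]
    congr 1
    rcases (hV0 x).eq_or_lt with h | h
    · rw [← h, Real.zero_rpow hp0.ne', mul_zero]
    · rw [← Real.rpow_add_one h.ne']; congr 1; ring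
  have hf : ∀ x a, |a| ≤ V x → |f a| ≤ C * V x ^ (p - 1) := by
    intro x a ha
    refine (hCf a (ha.trans (hVM x))).trans (mul_le_mul_of_nonneg_left ?_ hC)
    exact Real.rpow_le_rpow (abs_nonneg _) ha (by linarith)
  refine ⟨fun x => C * V x ^ p, hV.mul_left C,
    fun x => mul_nonneg hC (Real.rpow_nonneg (hV0 x) _), fun x a b ha hb => ⟨?_, ?_⟩⟩
  · have h1 := intervalIntegral.norm_integral_le_of_norm_le_const (f := f) (a := 0) (b := a)
      (C := C * V x ^ (p - 1)) (fun r hr => by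
        refine hf x r (le_trans ?_ ha)
        have h2 := Set.abs_sub_left_of_mem_uIcc (Set.uIoc_subset_uIcc hr)
        simpa using h2)
    rw [sub_zero, Real.norm_eq_abs] at h1
    refine h1.trans ?_
    simp only [← hpow]
    exact mul_le_mul_of_nonneg_left ha (mul_nonneg hC (Real.rpow_nonneg (hV0 x) _))
  · simp only [← hpow]
    rw [abs_mul]
    exact mul_le_mul (hf x a ha) hb (abs_nonneg _) (mul_nonneg hC (Real.rpow_nonneg (hV0 x) _))

lemma summable_GG {G : Z d → ℝ} (hG : Summable G) (hG0 : ∀ x, 0 ≤ G x) (B : ℝ) :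
    Summable fun q : Z d × Z d => B * (G q.1 * G q.2) :=
  (hG.mul_of_nonneg hG hG0 hG0).mul_left B

lemma term_bound {α B : ℝ} (hB0 : 0 ≤ B) (hB : ∀ x y : Z d, |Riesz d α x y| ≤ B)
    {G : Z d → ℝ} (hG0 : ∀ x, 0 ≤ G x) (q : Z d × Z d) {a b : ℝ} (ha : |a| ≤ G q.2)
    (hb : |b| ≤ G q.1) : ‖Riesz d α q.1 q.2 * a * b‖ ≤ B * (G q.1 * G q.2) := by
  rw [Real.norm_eq_abs, abs_mul, abs_mul, mul_assoc]
  refine mul_le_mul (hB _ _) ?_ (by positivity) hB0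
  rw [mul_comm (G q.1)]
  exact mul_le_mul ha hb (abs_nonneg _) (hG0 _)

lemma conv_sum_eq {α B : ℝ} (hB0 : 0 ≤ B) (hB : ∀ x y : Z d, |Riesz d α x y| ≤ B)
    {G : Z d → ℝ} (hG : Summable G) (hG0 : ∀ x, 0 ≤ G x) {g k : Z d → ℝ}
    (hg : ∀ x, |g x| ≤ G x) (hk : ∀ x, |k x| ≤ G x) :
    ∑' x, conv d α g x * k x = ∑' q : Z d × Z d, Riesz d α q.1 q.2 * g q.2 * k q.1 := by
  have hs : Summable fun q : Z d × Z d => Riesz d α q.1 q.2 * g q.2 * k q.1 :=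
    Summable.of_norm_bounded (summable_GG hG hG0 B)
      fun q => term_bound hB0 hB hG0 q (hg _) (hk _)
  rw [hs.tsum_prod]
  refine tsum_congr fun x => ?_
  unfold conv
  exact tsum_mul_right.symm

lemma conv_sum_continuousOn {α B : ℝ} (hB0 : 0 ≤ B) (hB : ∀ x y : Z d, |Riesz d α x y| ≤ B)
    {G : Z d → ℝ} (hG : Summable G) (hG0 : ∀ x, 0 ≤ G x) {X : Type*} [TopologicalSpace X]
    {S : Set X} {g k : X → Z d → ℝ}
    (hg : ∀ s ∈ S, ∀ x, |g s x| ≤ G x) (hk : ∀ s ∈ S, ∀ x, |k s x| ≤ G x)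
    (hgc : ∀ x, ContinuousOn (fun s => g s x) S) (hkc : ∀ x, ContinuousOn (fun s => k s x) S) :
    ContinuousOn (fun s => ∑' x, conv d α (g s) x * k s x) S := by
  have h1 : ContinuousOn (fun s => ∑' q : Z d × Z d,
      Riesz d α q.1 q.2 * g s q.2 * k s q.1) S := by
    refine continuousOn_tsum (fun q => ?_) (summable_GG hG hG0 B)
      (fun q s hs => term_bound hB0 hB hG0 q (hg s hs _) (hk s hs _))
    exact (continuousOn_const.mul (hgc _)).mul (hkc _)
  exact h1.congr fun s hs => conv_sum_eq hB0 hB hG hG0 (hg s hs) (hk s hs)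

lemma conv_sum_hasDerivAt {α B : ℝ} (hB0 : 0 ≤ B) (hB : ∀ x y : Z d, |Riesz d α x y| ≤ B)
    {G : Z d → ℝ} (hG : Summable G) (hG0 : ∀ x, 0 ≤ G x)
    {S : Set ℝ} (hS : IsOpen S) (hS' : IsPreconnected S) {g k : ℝ → Z d → ℝ}
    (hg : ∀ s ∈ S, ∀ x, |g s x| ≤ G x) (hk : ∀ s ∈ S, ∀ x, |k s x| ≤ G x)
    (hgc : ∀ s ∈ S, ∀ x, HasDerivAt (fun s => g s x) (k s x) s) {s : ℝ} (hs : s ∈ S) :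
    HasDerivAt (fun s => (1 / 2) * ∑' x, conv d α (g s) x * g s x)
      (∑' x, conv d α (g s) x * k s x) s := by
  have hsum1 : Summable fun q : Z d × Z d => Riesz d α q.1 q.2 * g s q.2 * k s q.1 :=
    Summable.of_norm_bounded (summable_GG hG hG0 B)
      fun q => term_bound hB0 hB hG0 q (hg s hs _) (hk s hs _)
  have hsum2 : Summable fun q : Z d × Z d => Riesz d α q.1 q.2 * k s q.2 * g s q.1 :=
    Summable.of_norm_bounded (summable_GG hG hG0 B)
      fun q => term_bound hB0 hB hG0 q (hk s hs _) (hg s hs _)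
  have hsum0 : Summable fun q : Z d × Z d => Riesz d α q.1 q.2 * g s q.2 * g s q.1 :=
    Summable.of_norm_bounded (summable_GG hG hG0 B)
      fun q => term_bound hB0 hB hG0 q (hg s hs _) (hg s hs _)
  have hder : HasDerivAt (fun s => ∑' q : Z d × Z d, Riesz d α q.1 q.2 * g s q.2 * g s q.1)
      (∑' q : Z d × Z d, (Riesz d α q.1 q.2 * k s q.2 * g s q.1 +
        Riesz d α q.1 q.2 * g s q.2 * k s q.1)) s := by
    refine hasDerivAt_tsum_of_isPreconnected
      (g' := fun (q : Z d × Z d) s => Riesz d α q.1 q.2 * k s q.2 * g s q.1 +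
        Riesz d α q.1 q.2 * g s q.2 * k s q.1)
      ((summable_GG hG hG0 B).add (summable_GG hG hG0 B)) hS hS' ?_ ?_ hs hsum0 hs
    · intro q z hz
      exact ((hgc z hz q.2).const_mul _).mul (hgc z hz q.1)
    · intro q z hz
      exact (norm_add_le _ _).trans (add_le_add
        (term_bound hB0 hB hG0 q (hk z hz _) (hg z hz _))
        (term_bound hB0 hB hG0 q (hg z hz _) (hk z hz _)))
  have hsw : ∑' q : Z d × Z d, Riesz d α q.1 q.2 * k s q.2 * g s q.1 =
      ∑' q : Z d × Z d, Riesz d α q.1 q.2 * g s q.2 * k s q.1 := by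
    rw [← (Equiv.prodComm (Z d) (Z d)).tsum_eq]
    refine tsum_congr fun q => ?_
    simp only [Equiv.prodComm_apply, Prod.fst_swap, Prod.snd_swap]
    rw [riesz_symm]; ring
  rw [hsum2.tsum_add hsum1, hsw, ← conv_sum_eq hB0 hB hG hG0 (hg s hs) (hk s hs)] at hder
  have h3 := hder.const_mul (1 / 2 : ℝ)
  have h4 : (1 / 2 : ℝ) * (∑' x, conv d α (g s) x * k s x + ∑' x, conv d α (g s) x * k s x)
      = ∑' x, conv d α (g s) x * k s x := by ring
  rw [h4] at h3
  refine h3.congr_of_eventuallyEq ?_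
  filter_upwards [hS.mem_nhds hs] with z hz
  rw [conv_sum_eq hB0 hB hG hG0 (hg z hz) (hg z hz)]

/-! ### The gradient term -/

/-- The function `t u + σ φ`. -/
def combo (u φ : Z d → ℝ) (q : ℝ × ℝ) : Z d → ℝ := fun x => q.1 * u x + q.2 * φ x

/-- Convergence of the series defining the gradient. -/
def FibS (W : Z d → Z d → ℝ) (u : Z d → ℝ) : Prop :=
  ∀ x : Z d, Summable fun y : Z d => W x y * (u x - u y) ^ 2

lemma FibS.cross {W : Z d → Z d → ℝ} (hW : ∀ x y, 0 < W x y) {u v : Z d → ℝ}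
    (hu : FibS W u) (hv : FibS W v) (x : Z d) :
    Summable fun y => W x y * (u x - u y) * (v x - v y) := by
  refine Summable.of_norm_bounded ((hu x).add (hv x)) fun y => ?_
  have h1 := (hW x y).le
  rw [Real.norm_eq_abs, abs_le]
  constructor
  · nlinarith [mul_nonneg h1 (sq_nonneg ((u x - u y) + (v x - v y))),
      mul_nonneg h1 (sq_nonneg (u x - u y)), mul_nonneg h1 (sq_nonneg (v x - v y))]
  · nlinarith [mul_nonneg h1 (sq_nonneg ((u x - u y) - (v x - v y))),
      mul_nonneg h1 (sq_nonneg (u x - u y)), mul_nonneg h1 (sq_nonneg (v x - v y))]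

lemma FibS.combo {W : Z d → Z d → ℝ} (hW : ∀ x y, 0 < W x y) {u v : Z d → ℝ}
    (hu : FibS W u) (hv : FibS W v) (q : ℝ × ℝ) : FibS W (combo u v q) := by
  intro x
  refine (((hu x).mul_left (q.1 ^ 2)).add (((hu.cross hW hv x).mul_left (2 * q.1 * q.2)).add
    ((hv x).mul_left (q.2 ^ 2)))).congr fun y => ?_
  simp only [DiscreteChoquard.combo]
  ring

lemma gradForm_combo_left {W : Z d → Z d → ℝ} (hW : ∀ x y, 0 < W x y) {u φ v : Z d → ℝ}
    (hu : FibS W u) (hφ : FibS W φ) (hv : FibS W v) (q : ℝ × ℝ) (x : Z d) :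
    gradForm W (combo u φ q) v x = q.1 * gradForm W u v x + q.2 * gradForm W φ v x := by
  unfold gradForm
  have h1 := (hu.cross hW hv x).mul_left q.1
  have h2 := (hφ.cross hW hv x).mul_left q.2
  have : ∑' y, W x y * (combo u φ q x - combo u φ q y) * (v x - v y) =
      q.1 * ∑' y, W x y * (u x - u y) * (v x - v y) +
        q.2 * ∑' y, W x y * (φ x - φ y) * (v x - v y) := by
    rw [← tsum_mul_left, ← tsum_mul_left, ← h1.tsum_add h2]
    refine tsum_congr fun y => ?_
    simp only [combo]
    ring
  rw [this]; ring

lemma gradForm_comm (W : Z d → Z d → ℝ) (u v : Z d → ℝ) (x : Z d) :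
    gradForm W u v x = gradForm W v u x := by
  unfold gradForm
  congr 1
  exact tsum_congr fun y => by ring

lemma gradForm_combo_right {W : Z d → Z d → ℝ} (hW : ∀ x y, 0 < W x y) {u φ v : Z d → ℝ}
    (hu : FibS W u) (hφ : FibS W φ) (hv : FibS W v) (q : ℝ × ℝ) (x : Z d) :
    gradForm W v (combo u φ q) x = q.1 * gradForm W v u x + q.2 * gradForm W v φ x := by
  rw [gradForm_comm, gradForm_combo_left hW hu hφ hv, gradForm_comm W u, gradForm_comm W φ]

lemma gradForm_self_nonneg {W : Z d → Z d → ℝ} (hW : ∀ x y, 0 < W x y) (u : Z d → ℝ) (x : Z d) :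
    0 ≤ gradForm W u u x := by
  unfold gradForm
  refine mul_nonneg (by norm_num) (tsum_nonneg fun y => ?_)
  rw [mul_assoc]
  exact mul_nonneg (hW x y).le (mul_self_nonneg _)

lemma gradNorm_eq (W : Z d → Z d → ℝ) (u : Z d → ℝ) (x : Z d) :
    gradNorm W u x = Real.sqrt (gradForm W u u x) := by
  unfold gradNorm gradForm
  congr 2
  exact tsum_congr fun y => by ring

lemma gradNorm_sq {W : Z d → Z d → ℝ} (hW : ∀ x y, 0 < W x y) (u : Z d → ℝ) (x : Z d) :
    gradNorm W u x ^ 2 = gradForm W u u x := by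
  rw [gradNorm_eq, Real.sq_sqrt (gradForm_self_nonneg hW u x)]

lemma gradNorm_nonneg (W : Z d → Z d → ℝ) (u : Z d → ℝ) (x : Z d) : 0 ≤ gradNorm W u x :=
  Real.sqrt_nonneg _

lemma gradForm_combo_self {W : Z d → Z d → ℝ} (hW : ∀ x y, 0 < W x y) {u φ : Z d → ℝ}
    (hu : FibS W u) (hφ : FibS W φ) (q : ℝ × ℝ) (x : Z d) :
    gradForm W (combo u φ q) (combo u φ q) x = q.1 ^ 2 * gradForm W u u x +
      2 * q.1 * q.2 * gradForm W u φ x + q.2 ^ 2 * gradForm W φ φ x := by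
  rw [gradForm_combo_left hW hu hφ (hu.combo hW hφ q), gradForm_combo_right hW hu hφ hu,
    gradForm_combo_right hW hu hφ hφ, gradForm_comm W φ u]
  ring

lemma gradForm_cs {W : Z d → Z d → ℝ} (hW : ∀ x y, 0 < W x y) {u φ : Z d → ℝ}
    (hu : FibS W u) (hφ : FibS W φ) (x : Z d) :
    |gradForm W u φ x| ≤ gradNorm W u x * gradNorm W φ x := by
  have h1 : ∀ t : ℝ, 0 ≤ gradForm W u u x * (t * t) + (2 * gradForm W u φ x) * t +
      gradForm W φ φ x := by
    intro t
    have := gradForm_self_nonneg hW (combo u φ (t, 1)) x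
    rw [gradForm_combo_self hW hu hφ] at this
    simp only at this
    linarith
  have h2 := discrim_le_zero h1
  unfold discrim at h2
  rw [gradNorm_eq, gradNorm_eq, ← Real.sqrt_mul (gradForm_self_nonneg hW u x)]
  apply Real.abs_le_sqrt
  linarith

lemma gradNorm_combo_le {W : Z d → Z d → ℝ} (hW : ∀ x y, 0 < W x y) {u φ : Z d → ℝ}
    (hu : FibS W u) (hφ : FibS W φ) (q : ℝ × ℝ) (x : Z d) :
    gradNorm W (combo u φ q) x ≤ |q.1| * gradNorm W u x + |q.2| * gradNorm W φ x := by
  have h1 := gradNorm_nonneg W u x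
  have h2 := gradNorm_nonneg W φ x
  refine abs_le_of_sq_le_sq' ?_ (by positivity) |>.2
  rw [gradNorm_sq hW, gradForm_combo_self hW hu hφ, add_sq, mul_pow, mul_pow, sq_abs, sq_abs,
    gradNorm_sq hW, gradNorm_sq hW]
  have h3 := gradForm_cs hW hu hφ x
  have h4 : q.1 * q.2 * gradForm W u φ x ≤ |q.1| * |q.2| * (gradNorm W u x * gradNorm W φ x) := by
    refine (le_abs_self _).trans ?_
    rw [abs_mul, abs_mul]
    exact mul_le_mul_of_nonneg_left h3 (by positivity)
  nlinarith

lemma gradNorm_combo_continuous {W : Z d → Z d → ℝ} (hW : ∀ x y, 0 < W x y) {u φ : Z d → ℝ}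
    (hu : FibS W u) (hφ : FibS W φ) (x : Z d) :
    Continuous fun q => gradNorm W (combo u φ q) x := by
  simp only [gradNorm_eq, gradForm_combo_self hW hu hφ]
  fun_prop

/-- The convexity inequality used for both parts of the norm. -/
lemma convex_ineq {p X Y D : ℝ} (hp : 2 ≤ p) (hX : 0 ≤ X) (hY : 0 ≤ Y)
    (hD : X ^ 2 - X * Y ≤ D) : 1 / p * X ^ p ≤ 1 / p * Y ^ p + X ^ (p - 2) * D := by
  have hp0 : 0 < p := by linarith
  have hXp : X ^ (p - 2) * X ^ 2 = X ^ p := by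
    rw [← Real.rpow_natCast X 2, ← Real.rpow_add_of_nonneg hX (by linarith) (by norm_num)]
    congr 1; push_cast; ring
  have hXp1 : X ^ (p - 2) * X = X ^ (p - 1) := by
    nth_rewrite 2 [← Real.rpow_one X]
    rw [← Real.rpow_add_of_nonneg hX (by linarith) (by norm_num)]
    congr 1; ring
  have hconj : p.HolderConjugate (p / (p - 1)) := Real.HolderConjugate.conjExponent (by linarith)
  have hy := Real.young_inequality_of_nonneg hY (Real.rpow_nonneg hX (p - 1)) hconj
  have hp1 : p - 1 ≠ 0 := by linarith
  rw [← Real.rpow_mul hX, mul_div_cancel₀ _ hp1] at hy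
  have h1 : X ^ (p - 2) * (X ^ 2 - X * Y) ≤ X ^ (p - 2) * D :=
    mul_le_mul_of_nonneg_left hD (Real.rpow_nonneg hX _)
  have h2 : X ^ (p - 2) * (X ^ 2 - X * Y) = X ^ p - Y * X ^ (p - 1) := by
    rw [← hXp, ← hXp1]; ring
  have h3 : X ^ p / (p / (p - 1)) = X ^ p - 1 / p * X ^ p := by field_simp
  rw [h3] at hy
  rw [h2] at h1
  have h4 : Y ^ p / p = 1 / p * Y ^ p := by ring
  linarith

/-- Finitely supported functions belong to `H_{s,p}`. -/
lemma memH_of_finite {s p : ℝ} (hs : 0 < s) (hp : 2 ≤ p) {W : Z d → Z d → ℝ}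
    (hW : KernelOK d s W) (h : Z d → ℝ) {φ : Z d → ℝ} (hφ : (Function.support φ).Finite) :
    memH W h p φ := by
  have hWp := hW.2.1
  have h1 : Summable fun q : Z d × Z d => W q.1 q.2 * φ q.1 ^ 2 := by
    have hnn : 0 ≤ fun q : Z d × Z d => W q.1 q.2 * φ q.1 ^ 2 :=
      fun q => mul_nonneg (hWp _ _).le (sq_nonneg _)
    refine (summable_prod_of_nonneg hnn).2 ⟨?_, ?_⟩
    · intro x
      exact (summable_kernel hs hW x).mul_right (φ x ^ 2)
    · refine summable_of_hasFiniteSupport (hφ.subset ?_)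
      intro x hx hx0
      apply hx
      simp [hx0]
  have h2 : Summable fun q : Z d × Z d => W q.1 q.2 * φ q.2 ^ 2 := by
    refine ((Equiv.prodComm (Z d) (Z d)).summable_iff.2 h1).congr fun q => ?_
    simp [hW.1 q.1 q.2]
  have h3 : Summable fun q : Z d × Z d => W q.1 q.2 * (φ q.1 - φ q.2) ^ 2 := by
    refine Summable.of_nonneg_of_le (fun q => mul_nonneg (hWp _ _).le (sq_nonneg _)) (fun q => ?_)
      ((h1.mul_left 2).add (h2.mul_left 2))
    nlinarith [mul_nonneg (hWp q.1 q.2).le (sq_nonneg (φ q.1 + φ q.2))]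
  have hnn3 : 0 ≤ fun q : Z d × Z d => W q.1 q.2 * (φ q.1 - φ q.2) ^ 2 :=
    fun q => mul_nonneg (hWp _ _).le (sq_nonneg _)
  obtain ⟨hf, hg⟩ := (summable_prod_of_nonneg hnn3).1 h3
  refine ⟨hf, ?_⟩
  have hp0 : p ≠ 0 := by linarith
  have hg2 : Summable fun x => gradNorm W φ x ^ 2 := by
    refine (hg.mul_left (1 / 2)).congr fun x => ?_
    unfold gradNorm
    rw [Real.sq_sqrt]
    exact mul_nonneg (by norm_num) (tsum_nonneg fun y => mul_nonneg (hWp _ _).le (sq_nonneg _))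
  refine Summable.add ?_ ?_
  · refine Summable.of_nonneg_of_le (fun x => Real.rpow_nonneg (gradNorm_nonneg W φ x) _)
      (fun x => ?_) (hg2.mul_left ((∑' x, gradNorm W φ x ^ 2) ^ ((p - 2) / 2)))
    have hle : gradNorm W φ x ^ 2 ≤ ∑' x, gradNorm W φ x ^ 2 :=
      hg2.le_tsum x fun y _ => sq_nonneg _
    have h4 := Real.rpow_le_rpow (sq_nonneg _) hle (show 0 ≤ (p - 2) / 2 by linarith)
    have hn := gradNorm_nonneg W φ x
    have h5 : gradNorm W φ x ^ p = (gradNorm W φ x ^ 2) ^ ((p - 2) / 2) * gradNorm W φ x ^ 2 := by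
      rw [← Real.rpow_natCast _ 2, ← Real.rpow_mul hn,
        ← Real.rpow_add_of_nonneg hn (by push_cast; linarith) (by norm_num)]
      congr 1; push_cast; ring
    rw [h5]
    exact mul_le_mul_of_nonneg_right h4 (sq_nonneg _)
  · refine summable_of_hasFiniteSupport (hφ.subset ?_)
    intro x hx hx0
    apply hx
    simp [hx0, Real.zero_rpow hp0]

/-! ### The norm along two-parameter families -/

/-- The parameter square. -/
def sq2 : Set (ℝ × ℝ) := {q | |q.1| ≤ 2 ∧ |q.2| ≤ 2}

lemma pow_add_le {p a b : ℝ} (hp : 0 < p) (ha : 0 ≤ a) (hb : 0 ≤ b) :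
    (2 * (a + b)) ^ p ≤ 4 ^ p * (a ^ p + b ^ p) := by
  have h1 : 0 ≤ a ^ p := Real.rpow_nonneg ha _
  have h2 : 0 ≤ b ^ p := Real.rpow_nonneg hb _
  have h4 : (0 : ℝ) ≤ 4 ^ p := by positivity
  rcases le_total a b with h | h
  · calc (2 * (a + b)) ^ p ≤ (4 * b) ^ p :=
          Real.rpow_le_rpow (by positivity) (by linarith) hp.le
      _ = 4 ^ p * b ^ p := Real.mul_rpow (by norm_num) hb
      _ ≤ _ := mul_le_mul_of_nonneg_left (by linarith) h4
  · calc (2 * (a + b)) ^ p ≤ (4 * a) ^ p :=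
          Real.rpow_le_rpow (by positivity) (by linarith) hp.le
      _ = 4 ^ p * a ^ p := Real.mul_rpow (by norm_num) ha
      _ ≤ _ := mul_le_mul_of_nonneg_left (by linarith) h4

lemma pow_split {p X : ℝ} (hp : 2 ≤ p) (hX : 0 ≤ X) : X ^ (p - 2) * (X * X) = X ^ p := by
  rw [← sq, ← Real.rpow_natCast X 2, ← Real.rpow_add_of_nonneg hX (by linarith) (by norm_num)]
  congr 1; push_cast; ring

/-- The dominating functions. -/
def bigU (W : Z d → Z d → ℝ) (u φ : Z d → ℝ) (x : Z d) : ℝ :=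
  2 * (gradNorm W u x + gradNorm W φ x)

/-- The dominating functions. -/
def bigV (u φ : Z d → ℝ) (x : Z d) : ℝ := 2 * (|u x| + |φ x|)

lemma bigU_nonneg (W : Z d → Z d → ℝ) (u φ : Z d → ℝ) (x : Z d) : 0 ≤ bigU W u φ x := by
  have h1 := gradNorm_nonneg W u x
  have h2 := gradNorm_nonneg W φ x
  unfold bigU; positivity

lemma bigV_nonneg (u φ : Z d → ℝ) (x : Z d) : 0 ≤ bigV u φ x := by
  unfold bigV; positivity

lemma combo_le_bigV (u φ : Z d → ℝ) {q : ℝ × ℝ} (hq : q ∈ sq2) (x : Z d) :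
    |combo u φ q x| ≤ bigV u φ x := by
  unfold combo bigV
  refine (abs_add_le _ _).trans ?_
  rw [abs_mul, abs_mul, mul_add]
  exact add_le_add (mul_le_mul_of_nonneg_right hq.1 (abs_nonneg _))
    (mul_le_mul_of_nonneg_right hq.2 (abs_nonneg _))

/-- The standing assumptions on the weight, the potential and the two directions. -/
structure Ctx (W : Z d → Z d → ℝ) (h : Z d → ℝ) (p : ℝ) (u φ : Z d → ℝ) : Prop where
  hW : ∀ x y, 0 < W x y
  hh : ∃ h₀ : ℝ, 0 < h₀ ∧ ∀ x, h₀ ≤ h x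
  hp : 2 ≤ p
  hu : memH W h p u
  hφ : memH W h p φ

section
variable {W : Z d → Z d → ℝ} {h : Z d → ℝ} {p : ℝ} {u φ : Z d → ℝ}

lemma Ctx.h_nonneg (c : Ctx W h p u φ) (x : Z d) : 0 ≤ h x := by
  obtain ⟨h₀, h1, h2⟩ := c.hh
  exact h1.le.trans (h2 x)

lemma Ctx.gN_le (c : Ctx W h p u φ) {q : ℝ × ℝ} (hq : q ∈ sq2) (x : Z d) :
    gradNorm W (combo u φ q) x ≤ bigU W u φ x := by
  refine (gradNorm_combo_le c.hW c.hu.1 c.hφ.1 q x).trans ?_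
  unfold bigU
  rw [mul_add]
  exact add_le_add (mul_le_mul_of_nonneg_right hq.1 (gradNorm_nonneg _ _ _))
    (mul_le_mul_of_nonneg_right hq.2 (gradNorm_nonneg _ _ _))

lemma Ctx.summable_dom (c : Ctx W h p u φ) :
    Summable fun x => bigU W u φ x ^ p + h x * bigV u φ x ^ p := by
  have hp0 : 0 < p := by linarith [c.hp]
  refine Summable.of_nonneg_of_le (fun x => ?_) (fun x => ?_)
    ((c.hu.2.add c.hφ.2).mul_left (4 ^ p))
  · exact add_nonneg (Real.rpow_nonneg (bigU_nonneg _ _ _ _) _)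
      (mul_nonneg (c.h_nonneg x) (Real.rpow_nonneg (bigV_nonneg _ _ _) _))
  · have h1 := pow_add_le hp0 (gradNorm_nonneg W u x) (gradNorm_nonneg W φ x)
    have h2 := mul_le_mul_of_nonneg_left (pow_add_le hp0 (abs_nonneg (u x)) (abs_nonneg (φ x)))
      (c.h_nonneg x)
    unfold bigU bigV
    linarith

lemma Ctx.summable_V (c : Ctx W h p u φ) : Summable fun x => bigV u φ x ^ p := by
  obtain ⟨h₀, h0, h1⟩ := c.hh
  refine Summable.of_nonneg_of_le (fun x => Real.rpow_nonneg (bigV_nonneg _ _ _) _) (fun x => ?_)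
    (c.summable_dom.mul_left h₀⁻¹)
  have h2 : 0 ≤ bigV u φ x ^ p := Real.rpow_nonneg (bigV_nonneg _ _ _) _
  have h3 : 0 ≤ bigU W u φ x ^ p := Real.rpow_nonneg (bigU_nonneg _ _ _ _) _
  rw [inv_mul_eq_div, le_div_iff₀ h0]
  nlinarith [mul_le_mul_of_nonneg_right (h1 x) h2]

lemma Ctx.term_nonneg (c : Ctx W h p u φ) (v : Z d → ℝ) (x : Z d) :
    0 ≤ gradNorm W v x ^ p + h x * |v x| ^ p :=
  add_nonneg (Real.rpow_nonneg (gradNorm_nonneg _ _ _) _)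
    (mul_nonneg (c.h_nonneg x) (Real.rpow_nonneg (abs_nonneg _) _))

lemma Ctx.term_le (c : Ctx W h p u φ) {q : ℝ × ℝ} (hq : q ∈ sq2) (x : Z d) :
    gradNorm W (combo u φ q) x ^ p + h x * |combo u φ q x| ^ p ≤
      bigU W u φ x ^ p + h x * bigV u φ x ^ p := by
  have hp0 : 0 ≤ p := by linarith [c.hp]
  exact add_le_add (Real.rpow_le_rpow (gradNorm_nonneg _ _ _) (c.gN_le hq x) hp0)
    (mul_le_mul_of_nonneg_left
      (Real.rpow_le_rpow (abs_nonneg _) (combo_le_bigV u φ hq x) hp0) (c.h_nonneg x))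

lemma Ctx.memH_combo (c : Ctx W h p u φ) {q : ℝ × ℝ} (hq : q ∈ sq2) :
    memH W h p (combo u φ q) :=
  ⟨FibS.combo c.hW c.hu.1 c.hφ.1 q, Summable.of_nonneg_of_le (c.term_nonneg _)
    (c.term_le hq) c.summable_dom⟩

lemma combo_continuous (u φ : Z d → ℝ) (x : Z d) : Continuous fun q => combo u φ q x := by
  unfold combo; fun_prop

lemma Ctx.HnormP_continuousOn (c : Ctx W h p u φ) :
    ContinuousOn (fun q => HnormP W h p (combo u φ q)) sq2 := by
  have hp0 : 0 ≤ p := by linarith [c.hp]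
  refine continuousOn_tsum (fun x => Continuous.continuousOn ?_) c.summable_dom fun x q hq => ?_
  · exact ((gradNorm_combo_continuous c.hW c.hu.1 c.hφ.1 x).rpow_const fun _ => Or.inr hp0).add
      (continuous_const.mul ((combo_continuous u φ x).abs.rpow_const fun _ => Or.inr hp0))
  · rw [Real.norm_of_nonneg (c.term_nonneg _ x)]
    exact c.term_le hq x

/-- The linear part of the pairing. -/
def linA (W : Z d → Z d → ℝ) (h : Z d → ℝ) (p : ℝ) (w φ : Z d → ℝ) (x : Z d) : ℝ :=
  gradNorm W w x ^ (p - 2) * gradForm W w φ x + h x * |w x| ^ (p - 2) * w x * φ x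

lemma mul_pow_bound {p X Y U V : ℝ} (hp : 2 ≤ p) (hX : 0 ≤ X) (hXU : X ≤ U)
    (hY : |Y| ≤ X * V) (hVU : V ≤ U) : |X ^ (p - 2) * Y| ≤ U ^ p := by
  rw [abs_mul, abs_of_nonneg (Real.rpow_nonneg hX _), ← pow_split hp (hX.trans hXU)]
  refine mul_le_mul (Real.rpow_le_rpow hX hXU (by linarith)) ?_ (abs_nonneg _)
    (Real.rpow_nonneg (hX.trans hXU) _)
  exact hY.trans ((mul_le_mul_of_nonneg_left hVU hX).trans
    (mul_le_mul_of_nonneg_right hXU (hX.trans hXU)))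

lemma phi_le_bigV (u φ : Z d → ℝ) (x : Z d) : |φ x| ≤ bigV u φ x := by
  have := abs_nonneg (u x)
  have := abs_nonneg (φ x)
  unfold bigV; linarith

lemma u_le_bigV (u φ : Z d → ℝ) (x : Z d) : |u x| ≤ bigV u φ x := by
  have := abs_nonneg (u x)
  have := abs_nonneg (φ x)
  unfold bigV; linarith

lemma Ctx.linA_le (c : Ctx W h p u φ) {q : ℝ × ℝ} (hq : q ∈ sq2) (x : Z d) :
    ‖linA W h p (combo u φ q) φ x‖ ≤ bigU W u φ x ^ p + h x * bigV u φ x ^ p := by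
  unfold linA
  refine (norm_add_le _ _).trans (add_le_add ?_ ?_)
  · refine mul_pow_bound c.hp (gradNorm_nonneg _ _ _) (c.gN_le hq x)
      (gradForm_cs c.hW (FibS.combo c.hW c.hu.1 c.hφ.1 q) c.hφ.1 x) ?_
    have h1 := gradNorm_nonneg W u x
    have h2 := gradNorm_nonneg W φ x
    unfold bigU; linarith
  · rw [mul_assoc, mul_assoc, Real.norm_eq_abs, abs_mul, abs_of_nonneg (c.h_nonneg x)]
    refine mul_le_mul_of_nonneg_left ?_ (c.h_nonneg x)
    exact mul_pow_bound c.hp (abs_nonneg _) (combo_le_bigV u φ hq x)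
      (abs_mul _ _).le (phi_le_bigV u φ x)

lemma Ctx.linA_continuousOn (c : Ctx W h p u φ) :
    ContinuousOn (fun q => ∑' x, linA W h p (combo u φ q) φ x) sq2 := by
  have hp2 : 0 ≤ p - 2 := by linarith [c.hp]
  refine continuousOn_tsum (fun x => Continuous.continuousOn ?_) c.summable_dom
    fun x q hq => c.linA_le hq x
  unfold linA
  refine Continuous.add (Continuous.mul ?_ ?_) (Continuous.mul (Continuous.mul
    (continuous_const.mul ?_) (combo_continuous u φ x)) continuous_const)
  · exact (gradNorm_combo_continuous c.hW c.hu.1 c.hφ.1 x).rpow_const fun _ => Or.inr hp2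
  · simp only [gradForm_combo_left c.hW c.hu.1 c.hφ.1 c.hφ.1]
    fun_prop
  · exact (combo_continuous u φ x).abs.rpow_const fun _ => Or.inr hp2

lemma Ctx.convex (c : Ctx W h p u φ) {t σ : ℝ} (hq : (t, σ) ∈ sq2) :
    1 / p * HnormP W h p (combo u φ (t, σ)) ≤
      1 / p * HnormP W h p (combo u φ (t, 0)) + σ * ∑' x, linA W h p (combo u φ (t, σ)) φ x := by
  have hq0 : (t, (0 : ℝ)) ∈ sq2 := ⟨hq.1, by simp⟩
  have s1 := (c.memH_combo hq).2
  have s2 := (c.memH_combo hq0).2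
  have s3 : Summable fun x => linA W h p (combo u φ (t, σ)) φ x :=
    Summable.of_norm_bounded c.summable_dom fun x => c.linA_le hq x
  unfold HnormP
  rw [← tsum_mul_left, ← tsum_mul_left, ← tsum_mul_left,
    ← (s2.mul_left _).tsum_add (s3.mul_left _)]
  refine Summable.tsum_le_tsum (fun x => ?_) (s1.mul_left _)
    ((s2.mul_left _).add (s3.mul_left _))
  have f1 := FibS.combo c.hW c.hu.1 c.hφ.1 (t, σ)
  have f0 := FibS.combo c.hW c.hu.1 c.hφ.1 (t, 0)
  have g1 : gradNorm W (combo u φ (t, σ)) x ^ 2 -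
      gradNorm W (combo u φ (t, σ)) x * gradNorm W (combo u φ (t, 0)) x ≤
        σ * gradForm W (combo u φ (t, σ)) φ x := by
    have e1 := (le_abs_self _).trans (gradForm_cs c.hW f1 f0 x)
    rw [gradNorm_sq c.hW]
    rw [gradForm_combo_right c.hW c.hu.1 c.hφ.1 f1] at e1 ⊢
    simp only [zero_mul, add_zero] at e1
    linarith
  have g2 : |combo u φ (t, σ) x| ^ 2 - |combo u φ (t, σ) x| * |combo u φ (t, 0) x| ≤
      σ * (combo u φ (t, σ) x * φ x) := by
    rw [sq_abs, ← abs_mul]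
    have := le_abs_self (combo u φ (t, σ) x * combo u φ (t, 0) x)
    have e : combo u φ (t, σ) x ^ 2 - combo u φ (t, σ) x * combo u φ (t, 0) x =
      σ * (combo u φ (t, σ) x * φ x) := by
      simp only [combo]; ring
    linarith
  have k1 := convex_ineq c.hp (gradNorm_nonneg _ _ _) (gradNorm_nonneg _ _ _) g1
  have k2 := mul_le_mul_of_nonneg_left
    (convex_ineq c.hp (abs_nonneg _) (abs_nonneg _) g2) (c.h_nonneg x)
  unfold linA
  linarith

lemma gradNorm_smul (W : Z d → Z d → ℝ) (u φ : Z d → ℝ) {t : ℝ} (ht : 0 ≤ t) (x : Z d) :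
    gradNorm W (combo u φ (t, 0)) x = t * gradNorm W u x := by
  unfold gradNorm
  have : ∑' y, W x y * (combo u φ (t, 0) x - combo u φ (t, 0) y) ^ 2 =
      t ^ 2 * ∑' y, W x y * (u x - u y) ^ 2 := by
    rw [← tsum_mul_left]
    refine tsum_congr fun y => ?_
    simp only [combo]; ring
  rw [this, mul_left_comm, Real.sqrt_mul (sq_nonneg t), Real.sqrt_sq ht]

lemma HnormP_smul (W : Z d → Z d → ℝ) (h : Z d → ℝ) (p : ℝ) (u φ : Z d → ℝ) {t : ℝ}
    (ht : 0 ≤ t) : HnormP W h p (combo u φ (t, 0)) = t ^ p * HnormP W h p u := by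
  unfold HnormP
  rw [← tsum_mul_left]
  refine tsum_congr fun x => ?_
  rw [gradNorm_smul W u φ ht, Real.mul_rpow ht (gradNorm_nonneg _ _ _)]
  simp only [combo, zero_mul, add_zero]
  rw [abs_mul, Real.mul_rpow (abs_nonneg _) (abs_nonneg _), abs_of_nonneg ht]
  ring

end

/-! ### The main argument -/

lemma energy_eq {f : ℝ → ℝ} (hfz : ∀ t ≤ (0 : ℝ), f t = 0) (W : Z d → Z d → ℝ) (h : Z d → ℝ)
    (p α : ℝ) (v : Z d → ℝ) :
    energy W h p α f v = (1 / p) * HnormP W h p v -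
      (1 / 2) * ∑' x, conv d α (fun y => Fint f (v y)) x * Fint f (v x) := by
  unfold energy pos
  simp only [Fint_max hfz]

lemma nehari_sum_eq {f : ℝ → ℝ} (hfz : ∀ t ≤ (0 : ℝ), f t = 0) (α : ℝ) (v : Z d → ℝ) :
    ∑' x : Z d, conv d α (fun y => Fint f (pos v y)) x * f (pos v x) * pos v x =
      ∑' x, conv d α (fun y => Fint f (v y)) x * (f (v x) * v x) := by
  unfold pos
  simp only [Fint_max hfz, f_max hfz, mul_assoc, f_mul_max hfz]

lemma pairing_eq {f : ℝ → ℝ} (hfz : ∀ t ≤ (0 : ℝ), f t = 0) (W : Z d → Z d → ℝ) (h : Z d → ℝ)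
    (p α : ℝ) (v φ : Z d → ℝ) :
    pairing W h p α f v φ = ∑' x, linA W h p v φ x -
      ∑' x, conv d α (fun y => Fint f (v y)) x * (f (v x) * φ x) := by
  unfold pairing pos linA
  simp only [Fint_max hfz, f_max hfz, mul_assoc]

lemma f4_sum_eq {f : ℝ → ℝ} (hfz : ∀ t ≤ (0 : ℝ), f t = 0) (α : ℝ) (u φ : Z d → ℝ) {t : ℝ}
    (ht : 0 < t) :
    ∑' x : Z d, conv d α (fun y => Fint f (t * pos u y)) x * f (t * pos u x) * pos u x =
      ∑' x, conv d α (fun y => Fint f (combo u φ (t, 0) y)) x *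
        (f (combo u φ (t, 0) x) * u x) := by
  have h1 : ∀ a : ℝ, t * max a 0 = max (t * a) 0 := fun a => by
    rw [mul_max_of_nonneg _ _ ht.le, mul_zero]
  have h2 : ∀ a : ℝ, f (t * a) * max a 0 = f (t * a) * a := by
    intro a
    rcases le_total a 0 with h | h
    · rw [hfz (t * a) (mul_nonpos_of_nonneg_of_nonpos ht.le h)]; simp
    · rw [max_eq_left h]
  unfold pos combo
  simp only [h1, Fint_max hfz, f_max hfz, mul_assoc, h2, zero_mul, add_zero]

lemma core (hd : 0 < d) {s p : ℝ} (hs : s ∈ Set.Ioo (0 : ℝ) 1) (hp : 2 ≤ p)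
    {W : Z d → Z d → ℝ} (hW : KernelOK d s W)
    {α : ℝ} (hα : α ∈ Set.Ioo (0 : ℝ) (d : ℝ))
    {h : Z d → ℝ} {h₀ : ℝ} (hh₀ : 0 < h₀) (hh1 : ∀ x, h₀ ≤ h x)
    {f : ℝ → ℝ} (hfc : Continuous f) (hfz : ∀ t ≤ (0 : ℝ), f t = 0)
    (hf1 : F1 f p) (hf4 : F4 W h p α f)
    (u : Z d → ℝ) (hu₀ : u ∈ Nehari W h p α f)
    (hmin : ∀ v ∈ Nehari W h p α f, energy W h p α f u ≤ energy W h p α f v)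
    (φ : Z d → ℝ) (hφ : (Function.support φ).Finite) : 0 ≤ pairing W h p α f u φ := by
  by_contra! hneg
  have hp0 : 0 < p := by linarith
  obtain ⟨hu, hune, hN⟩ := hu₀
  have c : Ctx W h p u φ := ⟨hW.2.1, ⟨h₀, hh₀, hh1⟩, hp, hu, memH_of_finite hs.1 hp hW h hφ⟩
  obtain ⟨B, hB0, hB⟩ := riesz_bound hd hα
  obtain ⟨G, hG, hG0, hGb⟩ := nl_bounds hfc hfz hp hf1 (bigV_nonneg u φ) c.summable_V
  have hFc : Continuous (Fint f) :=
    continuous_iff_continuousAt.2 fun t => (Fint_hasDerivAt hfc t).continuousAt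
  have hw1 : combo u φ (1, 0) = u := by ext x; simp [combo]
  -- bounds along the family
  have bF : ∀ q ∈ sq2, ∀ x, |Fint f (combo u φ q x)| ≤ G x := fun q hq x =>
    (hGb x _ _ (combo_le_bigV u φ hq x) (phi_le_bigV u φ x)).1
  have bφ : ∀ q ∈ sq2, ∀ x, |f (combo u φ q x) * φ x| ≤ G x := fun q hq x =>
    (hGb x _ _ (combo_le_bigV u φ hq x) (phi_le_bigV u φ x)).2
  have bu : ∀ q ∈ sq2, ∀ x, |f (combo u φ q x) * u x| ≤ G x := fun q hq x =>
    (hGb x _ _ (combo_le_bigV u φ hq x) (u_le_bigV u φ x)).2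
  have bw : ∀ q ∈ sq2, ∀ x, |f (combo u φ q x) * combo u φ q x| ≤ G x := fun q hq x =>
    (hGb x _ _ (combo_le_bigV u φ hq x) (combo_le_bigV u φ hq x)).2
  -- abbreviations
  let A : ℝ × ℝ → ℝ := fun q => ∑' x, linA W h p (combo u φ q) φ x
  let Bf : ℝ × ℝ → ℝ := fun q => ∑' x, conv d α (fun y => Fint f (combo u φ q y)) x *
    (f (combo u φ q x) * φ x)
  let Nl : ℝ × ℝ → ℝ := fun q => ∑' x, conv d α (fun y => Fint f (combo u φ q y)) x *
    (f (combo u φ q x) * combo u φ q x)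
  let Su : ℝ × ℝ → ℝ := fun q => ∑' x, conv d α (fun y => Fint f (combo u φ q y)) x *
    (f (combo u φ q x) * u x)
  let N : ℝ × ℝ → ℝ := fun q => HnormP W h p (combo u φ q) - Nl q
  let E2 : ℝ × ℝ → ℝ := fun q => (1 / 2) * ∑' x,
    conv d α (fun y => Fint f (combo u φ q y)) x * Fint f (combo u φ q x)
  let H := HnormP W h p u
  have cA : ContinuousOn A sq2 := c.linA_continuousOn
  have cF : ∀ x, ContinuousOn (fun q => Fint f (combo u φ q x)) sq2 := fun x =>
    (hFc.comp (combo_continuous u φ x)).continuousOn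
  have cf : ∀ x, Continuous (fun q => f (combo u φ q x)) := fun x =>
    hfc.comp (combo_continuous u φ x)
  have cB : ContinuousOn Bf sq2 := conv_sum_continuousOn hB0 hB hG hG0 bF bφ cF
    (fun x => ((cf x).mul continuous_const).continuousOn)
  have cN : ContinuousOn N sq2 := c.HnormP_continuousOn.sub
    (conv_sum_continuousOn hB0 hB hG hG0 bF bw cF
      (fun x => ((cf x).mul (combo_continuous u φ x)).continuousOn))
  have hEn : ∀ q, energy W h p α f (combo u φ q) =
      1 / p * HnormP W h p (combo u φ q) - E2 q := fun q => energy_eq hfz W h p α _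
  -- derivatives of the nonlinear term
  have dσ : ∀ t, |t| ≤ 2 → ∀ σ ∈ Set.Ioo (-2 : ℝ) 2,
      HasDerivAt (fun σ => E2 (t, σ)) (Bf (t, σ)) σ := by
    intro t ht σ hσ
    have hmem : ∀ r ∈ Set.Ioo (-2 : ℝ) 2, (t, r) ∈ sq2 := fun r hr =>
      ⟨ht, abs_le.2 ⟨hr.1.le, hr.2.le⟩⟩
    refine conv_sum_hasDerivAt hB0 hB hG hG0 isOpen_Ioo isPreconnected_Ioo
      (g := fun σ x => Fint f (combo u φ (t, σ) x))
      (k := fun σ x => f (combo u φ (t, σ) x) * φ x)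
      (fun r hr => bF _ (hmem r hr)) (fun r hr => bφ _ (hmem r hr)) (fun r hr x => ?_) hσ
    have h1 : HasDerivAt (fun σ => combo u φ (t, σ) x) (φ x) r := by
      simpa [combo] using ((hasDerivAt_id r).mul_const (φ x)).const_add (t * u x)
    exact (Fint_hasDerivAt hfc (combo u φ (t, r) x)).comp r h1
  have dt : ∀ t ∈ Set.Ioo (-2 : ℝ) 2, HasDerivAt (fun t => E2 (t, 0)) (Su (t, 0)) t := by
    intro t ht
    have hmem : ∀ r ∈ Set.Ioo (-2 : ℝ) 2, (r, (0 : ℝ)) ∈ sq2 := fun r hr =>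
      ⟨abs_le.2 ⟨hr.1.le, hr.2.le⟩, by simp⟩
    refine conv_sum_hasDerivAt hB0 hB hG hG0 isOpen_Ioo isPreconnected_Ioo
      (g := fun t x => Fint f (combo u φ (t, 0) x))
      (k := fun t x => f (combo u φ (t, 0) x) * u x)
      (fun r hr => bF _ (hmem r hr)) (fun r hr => bu _ (hmem r hr)) (fun r hr x => ?_) ht
    have h1 : HasDerivAt (fun t => combo u φ (t, 0) x) (u x) r := by
      simpa [combo] using ((hasDerivAt_id r).mul_const (u x))
    exact (Fint_hasDerivAt hfc (combo u φ (r, 0) x)).comp r h1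
  -- the fibering map
  have hNH : H = Su (1, 0) := by
    have := hN
    rw [nehari_sum_eq hfz] at this
    simp only [Su, hw1]
    exact this
  have hupos : pos u ≠ 0 := by
    intro h0
    have hH0 : HnormP W h p u = 0 := by
      rw [hN, h0]; simp
    apply hune
    ext x
    have hs0 := hu.2.hasSum
    change HasSum _ (HnormP W h p u) at hs0
    rw [hH0] at hs0
    have h1 := (hasSum_zero_iff_of_nonneg (c.term_nonneg u)).1 hs0
    have h2 := congrFun h1 x
    simp only [Pi.zero_apply] at h2
    have h3 : 0 ≤ gradNorm W u x ^ p := Real.rpow_nonneg (gradNorm_nonneg _ _ _) _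
    by_contra hx
    have h4 : 0 < h x * |u x| ^ p :=
      mul_pos (hh₀.trans_le (hh1 x)) (Real.rpow_pos_of_pos (abs_pos.2 hx) _)
    linarith
  have hm : StrictMonoOn (fun t : ℝ => t ^ (1 - p) * Su (t, 0)) (Set.Ioi 0) := by
    refine (hf4 u hu hupos).congr fun t ht => ?_
    simp only [Su]
    rw [f4_sum_eq hfz α u φ ht]
  have hm1 : ∀ t, 0 < t → Su (t, 0) = t ^ (p - 1) * (t ^ (1 - p) * Su (t, 0)) := by
    intro t ht
    rw [← mul_assoc, ← Real.rpow_add ht]; simp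
  have hlt : ∀ t, 0 < t → t < 1 → Su (t, 0) < t ^ (p - 1) * H := by
    intro t ht ht1
    have := hm ht (Set.mem_Ioi.2 one_pos) ht1
    simp only [Real.one_rpow, one_mul, ← hNH] at this
    rw [hm1 t ht]
    exact mul_lt_mul_of_pos_left this (Real.rpow_pos_of_pos ht _)
  have hgt : ∀ t, 1 < t → t ^ (p - 1) * H < Su (t, 0) := by
    intro t ht1
    have ht : 0 < t := one_pos.trans ht1
    have := hm (Set.mem_Ioi.2 one_pos) ht ht1
    simp only [Real.one_rpow, one_mul, ← hNH] at this
    rw [hm1 t ht]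
    exact mul_lt_mul_of_pos_left this (Real.rpow_pos_of_pos ht _)
  -- sign of N on the ray
  have hNray : ∀ t, 0 < t → N (t, 0) = t * (t ^ (p - 1) * H - Su (t, 0)) := by
    intro t ht
    have h1 : Nl (t, 0) = t * Su (t, 0) := by
      simp only [Nl, Su]
      rw [← tsum_mul_left]
      refine tsum_congr fun x => ?_
      have : combo u φ (t, 0) x = t * u x := by simp [combo]
      rw [this]; ring
    have h2 : t ^ p = t * t ^ (p - 1) := by
      rw [← Real.rpow_one_add' ht.le (by linarith)]; congr 1; ring
    simp only [N]
    rw [HnormP_smul W h p u φ ht.le, h1, h2]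
    simp only [H]; ring
  -- the energy on the ray
  have dj : ∀ t ∈ Set.Ioo (0 : ℝ) 2, HasDerivAt (fun t => 1 / p * (t ^ p * H) - E2 (t, 0))
      (t ^ (p - 1) * H - Su (t, 0)) t := by
    intro t ht
    have h1 := (((Real.hasDerivAt_rpow_const (p := p) (Or.inl ht.1.ne')).mul_const H).const_mul
      (1 / p)).sub (dt t ⟨by linarith [ht.1], ht.2⟩)
    have h2 : 1 / p * (p * t ^ (p - 1) * H) = t ^ (p - 1) * H := by field_simp
    rwa [h2] at h1
  have hray : ∀ t ∈ Set.Ioo (0 : ℝ) 2,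
      energy W h p α f (combo u φ (t, 0)) ≤ energy W h p α f u := by
    intro t ht
    have e1 : energy W h p α f u = 1 / p * ((1 : ℝ) ^ p * H) - E2 (1, 0) := by
      conv_lhs => rw [← hw1]
      rw [hEn, HnormP_smul W h p u φ zero_le_one]
    rw [e1, hEn, HnormP_smul W h p u φ ht.1.le]
    change 1 / p * (t ^ p * H) - E2 (t, 0) ≤ _
    rcases lt_trichotomy t 1 with h1 | h1 | h1
    · obtain ⟨r, hr, hr2⟩ := exists_hasDerivAt_eq_slope
        (fun t => 1 / p * (t ^ p * H) - E2 (t, 0)) (fun t => t ^ (p - 1) * H - Su (t, 0)) h1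
        (fun r hr => (dj r ⟨ht.1.trans_le hr.1, by linarith [hr.2]⟩).continuousAt.continuousWithinAt)
        (fun r hr => dj r ⟨ht.1.trans hr.1, by linarith [hr.2]⟩)
      have h3 := hlt r (ht.1.trans hr.1) hr.2
      rw [eq_div_iff (by linarith)] at hr2
      have h4 := mul_pos (sub_pos.2 h3) (sub_pos.2 h1)
      linarith
    · rw [h1]
    · obtain ⟨r, hr, hr2⟩ := exists_hasDerivAt_eq_slope
        (fun t => 1 / p * (t ^ p * H) - E2 (t, 0)) (fun t => t ^ (p - 1) * H - Su (t, 0)) h1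
        (fun r hr => (dj r ⟨by linarith [hr.1], by linarith [hr.2, ht.2]⟩).continuousAt.continuousWithinAt)
        (fun r hr => dj r ⟨by linarith [hr.1], by linarith [hr.2, ht.2]⟩)
      have h3 := hgt r hr.1
      rw [eq_div_iff (by linarith)] at hr2
      have h4 := mul_pos (sub_pos.2 h3) (sub_pos.2 h1)
      linarith
  -- local negativity
  have hAB : A (1, 0) < Bf (1, 0) := by
    rw [pairing_eq hfz] at hneg
    simp only [A, Bf, hw1]
    linarith
  have hsqn : ∀ q : ℝ × ℝ, |q.1| < 2 → |q.2| < 2 → sq2 ∈ 𝓝 q := by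
    intro q h1 h2
    have ho : IsOpen {q : ℝ × ℝ | |q.1| < 2 ∧ |q.2| < 2} :=
      (isOpen_lt continuous_fst.abs continuous_const).inter
        (isOpen_lt continuous_snd.abs continuous_const)
    exact mem_of_superset (ho.mem_nhds ⟨h1, h2⟩) fun q hq => ⟨hq.1.le, hq.2.le⟩
  obtain ⟨ε, hε0, hε1, hεAB⟩ : ∃ ε : ℝ, 0 < ε ∧ ε ≤ 1 / 2 ∧ ∀ q : ℝ × ℝ, |q.1 - 1| ≤ ε →
      |q.2| ≤ ε → A q < (A (1, 0) + Bf (1, 0)) / 2 ∧ (A (1, 0) + Bf (1, 0)) / 2 < Bf q := by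
    have hn := hsqn (1, 0) (by norm_num) (by norm_num)
    have e1 := (cA.continuousAt hn).eventually_lt_const
      (show A (1, 0) < (A (1, 0) + Bf (1, 0)) / 2 by linarith)
    have e2 := (cB.continuousAt hn).eventually_const_lt
      (show (A (1, 0) + Bf (1, 0)) / 2 < Bf (1, 0) by linarith)
    obtain ⟨δ, hδ, hδ2⟩ := Metric.eventually_nhds_iff.1 (e1.and e2)
    refine ⟨min (δ / 2) (1 / 2), by positivity, min_le_right _ _, fun q h1 h2 => hδ2 ?_⟩
    have h3 := min_le_left (δ / 2) (1 / 2 : ℝ)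
    rw [Prod.dist_eq, Real.dist_eq, Real.dist_eq]
    simp only [sub_zero]
    exact max_lt (by linarith) (by linarith)
  -- choice of σ
  obtain ⟨x₀, hx₀⟩ := Function.ne_iff.1 hune
  simp only [Pi.zero_apply] at hx₀
  have hcurve : ∀ t : ℝ, |t| < 2 → ContinuousAt (fun σ : ℝ => N (t, σ)) 0 := fun t ht =>
    ContinuousAt.comp (f := fun σ : ℝ => (t, σ)) (g := N)
      (cN.continuousAt (hsqn (t, 0) ht (by norm_num))) (by fun_prop)
  have sgn1 : 0 < N (1 - ε, 0) := by
    rw [hNray _ (by linarith)]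
    exact mul_pos (by linarith) (sub_pos.2 (hlt _ (by linarith) (by linarith)))
  have sgn2 : N (1 + ε, 0) < 0 := by
    rw [hNray _ (by linarith)]
    exact mul_neg_of_pos_of_neg (by linarith) (sub_neg.2 (hgt _ (by linarith)))
  have ev1 := (hcurve (1 - ε) (abs_lt.2 ⟨by linarith, by linarith⟩)).eventually_const_lt sgn1
  have ev2 := (hcurve (1 + ε) (abs_lt.2 ⟨by linarith, by linarith⟩)).eventually_lt_const sgn2
  have ev3 : ∀ᶠ σ : ℝ in 𝓝 0, |σ * φ x₀| < |u x₀| / 2 := by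
    have : ContinuousAt (fun σ : ℝ => |σ * φ x₀|) 0 := by fun_prop
    refine this.eventually_lt_const ?_
    have := abs_pos.2 hx₀
    simp only [zero_mul, abs_zero]
    positivity
  have ev4 : ∀ᶠ σ : ℝ in 𝓝 0, σ < ε := eventually_lt_nhds hε0
  have evs := ((ev1.and (ev2.and (ev3.and ev4))).filter_mono
    (nhdsWithin_le_nhds (s := Set.Ioi (0 : ℝ)))).and self_mem_nhdsWithin
  obtain ⟨σ, ⟨s1, s2, s3, s4⟩, s5⟩ := evs.exists
  have s5' : 0 < σ := s5
  -- intermediate value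
  have hivt : (0 : ℝ) ∈ (fun t => N (t, σ)) '' Set.Icc (1 - ε) (1 + ε) := by
    refine intermediate_value_Icc' (by linarith) ?_ ⟨s2.le, s1.le⟩
    refine cN.comp (f := fun t : ℝ => (t, σ)) (by fun_prop) fun t ht => ?_
    exact ⟨abs_le.2 ⟨by linarith [ht.1], by linarith [ht.2]⟩,
      abs_le.2 ⟨by linarith, by linarith⟩⟩
  obtain ⟨t, ht, hNt⟩ := hivt
  have hNt' : HnormP W h p (combo u φ (t, σ)) - Nl (t, σ) = 0 := hNt
  have ht2 : |t| ≤ 2 := abs_le.2 ⟨by linarith [ht.1], by linarith [ht.2]⟩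
  have hq : (t, σ) ∈ sq2 := ⟨ht2, abs_le.2 ⟨by linarith, by linarith⟩⟩
  have hmemN : combo u φ (t, σ) ∈ Nehari W h p α f := by
    refine ⟨c.memH_combo hq, ?_, ?_⟩
    · intro h0
      have h1 := congrFun h0 x₀
      simp only [combo, Pi.zero_apply] at h1
      have h2 : |t * u x₀| = |σ * φ x₀| := by
        rw [eq_neg_of_add_eq_zero_left h1, abs_neg]
      rw [abs_mul, abs_of_pos (by linarith [ht.1] : (0 : ℝ) < t)] at h2
      have h3 := abs_pos.2 hx₀
      nlinarith [ht.1]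
    · rw [nehari_sum_eq hfz]
      exact sub_eq_zero.1 hNt'
  have hfin := hmin _ hmemN
  have hr1 := hray t ⟨by linarith [ht.1], by linarith [ht.2]⟩
  have hconv := c.convex hq
  obtain ⟨r, hr, hr2⟩ := exists_hasDerivAt_eq_slope (fun σ => E2 (t, σ)) (fun σ => Bf (t, σ)) s5'
    (fun r hr => (dσ t ht2 r ⟨by linarith [hr.1], by linarith [hr.2]⟩).continuousAt.continuousWithinAt)
    (fun r hr => dσ t ht2 r ⟨by linarith [hr.1], by linarith [hr.2]⟩)
  rw [eq_div_iff (by linarith)] at hr2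
  have ht1 : |t - 1| ≤ ε := abs_le.2 ⟨by linarith [ht.1], by linarith [ht.2]⟩
  have k1 := (hεAB (t, σ) ht1 (abs_le.2 ⟨by linarith, s4.le⟩)).1
  have k2 := (hεAB (t, r) ht1 (abs_le.2 ⟨by linarith [hr.1], by linarith [hr.2]⟩)).2
  rw [hEn] at hfin hr1
  change _ ≤ _ + σ * A (t, σ) at hconv
  have k3 := mul_pos (sub_pos.2 (k1.trans k2)) s5'
  rw [sub_mul] at k3
  linarith

lemma pairing_neg (W : Z d → Z d → ℝ) (h : Z d → ℝ) (p α : ℝ) (f : ℝ → ℝ) (u φ : Z d → ℝ) :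
    pairing W h p α f u (-φ) = - pairing W h p α f u φ := by
  have h1 : ∀ x, gradForm W u (-φ) x = - gradForm W u φ x := by
    intro x
    unfold gradForm
    rw [← mul_neg, ← tsum_neg]
    congr 1
    refine tsum_congr fun y => ?_
    simp only [Pi.neg_apply]; ring
  unfold pairing
  rw [neg_sub', ← tsum_neg, ← tsum_neg]
  congr 1
  · refine tsum_congr fun x => ?_
    rw [h1]; simp only [Pi.neg_apply]; ring
  · refine tsum_congr fun x => ?_
    simp only [Pi.neg_apply]; ring

theorem nehari_minimizer_is_critical_point
    {d : ℕ} (hd : 0 < d) {s p : ℝ} (hs : s ∈ Set.Ioo (0 : ℝ) 1) (hp : 2 ≤ p)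
    {W : Z d → Z d → ℝ} (hW : KernelOK d s W)
    {α : ℝ} (hα : α ∈ Set.Ioo (0 : ℝ) (d : ℝ))
    {h : Z d → ℝ} {h₀ : ℝ} (hh₀ : 0 < h₀) (hh1 : ∀ x, h₀ ≤ h x)
    (hh2 : H2 h)
    {f : ℝ → ℝ} (hfc : Continuous f) (hfz : ∀ t ≤ (0 : ℝ), f t = 0)
    (hf1 : F1 f p)
    {C₀ τ : ℝ} (hC₀ : 0 < C₀) (hτ : ((d : ℝ) + α) * p / (2 * d) < τ)
    (hf2 : ∀ t > (0 : ℝ), f t ≤ C₀ * (1 + t ^ (τ - 1)))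
    {θ : ℝ} (hθ : p < θ) (hf3 : F3 f θ)
    (hf4 : F4 W h p α f)
    (u₀ : Z d → ℝ) (hu₀ : u₀ ∈ Nehari W h p α f)
    (hmin : ∀ v ∈ Nehari W h p α f, energy W h p α f u₀ ≤ energy W h p α f v) :
    ∀ φ : Z d → ℝ, (Function.support φ).Finite → pairing W h p α f u₀ φ = 0 := by
  intro φ hφ
  have h1 := core hd hs hp hW hα hh₀ hh1 hfc hfz hf1 hf4 u₀ hu₀ hmin φ hφ
  have h2 := core hd hs hp hW hα hh₀ hh1 hfc hfz hf1 hf4 u₀ hu₀ hmin (-φ)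
    (by rwa [Function.support_neg])
  rw [pairing_neg] at h2
  linarith

end DiscreteChoquard
end
end

section
/- Assume (h1) and (f1)–(f3). For every ε > 0 there exists C_ε > 0 (depending on ε, d, α, p, τ, h_0 and f) such that for every u : ℤ^d → ℝ with ‖u‖_{H_{s,p}} < ∞, writing u⁺ = max(u,0), both double series below converge absolutely and ∑_{x∈ℤ^d}(R_α∗F(u⁺))(x)·F(u⁺(x)) ≤ ε‖u‖_{H_{s,p}}^{2p} + C_ε‖u‖_{H_{s,p}}^{2τ} and ∑_{x∈ℤ^d}(R_α∗F(u⁺))(x)·f(u⁺(x))·u⁺(x) ≤ ε‖u‖_{H_{s,p}}^{2p} + C_ε‖u‖_{H_{s,p}}^{2τ}. -/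
open MeasureTheory Filter Topology
open scoped ENNReal

noncomputable section

namespace DiscreteChoquard

variable {d : ℕ}

/-- Weights of the double exponential series. -/
def cw (t : ℝ) (q : ℕ × ℕ) : ℝ :=
  Real.exp (-(2 * t)) * ((t ^ q.1 / (q.1.factorial : ℝ)) * (t ^ q.2 / (q.2.factorial : ℝ)))

theorem cw_nonneg {t : ℝ} (ht : 0 ≤ t) (q : ℕ × ℕ) : 0 ≤ cw t q := by
  unfold cw; positivity

theorem cw_hasSum (t : ℝ) : HasSum (cw t) 1 := by
  have h1 : HasSum (fun n : ℕ => t ^ n / (n.factorial : ℝ)) (Real.exp t) := by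
    rw [Real.exp_eq_exp_ℝ]; exact NormedSpace.expSeries_div_hasSum_exp t
  have h2 := h1.mul h1 (summable_mul_of_summable_norm h1.summable.norm h1.summable.norm)
  have h3 := h2.mul_left (Real.exp (-(2 * t)))
  have : Real.exp (-(2 * t)) * (Real.exp t * Real.exp t) = 1 := by
    rw [← Real.exp_add, ← Real.exp_add]; simp; ring
  rw [this] at h3
  exact h3

theorem int_exp_orth (m : ℤ) :
    ∫ k in (0 : ℝ)..(2 * Real.pi), Complex.exp ((m : ℂ) * Complex.I * k)
      = if m = 0 then ((2 * Real.pi : ℝ) : ℂ) else 0 := by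
  split_ifs with h
  · simp [h]
  · rw [integral_exp_mul_complex (by simp [h])]
    have : Complex.exp ((m : ℂ) * Complex.I * ((2 * Real.pi : ℝ) : ℂ)) = 1 := by
      rw [Complex.exp_eq_one_iff]
      exact ⟨m, by push_cast; ring⟩
    rw [this]; simp

theorem hz (z : ℂ) : HasSum (fun n : ℕ => z ^ n / (n.factorial : ℂ)) (Complex.exp z) := by
  rw [Complex.exp_eq_exp_ℂ]; exact NormedSpace.expSeries_div_hasSum_exp z

theorem hmulC {f g : ℕ → ℂ} {A B : ℂ} (h1 : HasSum f A) (h2 : HasSum g B) :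
    HasSum (fun q : ℕ × ℕ => f q.1 * g q.2) (A * B) := by
  have a := h1.summable.norm
  have b := h2.summable.norm
  exact HasSum.mul h1 h2 (summable_mul_of_summable_norm a b)

/-- Terms of the exponential series. -/
def exT (z : ℂ) (n : ℕ) : ℂ := z ^ n / (n.factorial : ℂ)

theorem hz' (z : ℂ) : HasSum (exT z) (Complex.exp z) := hz z

theorem hz2 (z w : ℂ) : HasSum (fun q : ℕ × ℕ => exT z q.1 * exT w q.2)
    (Complex.exp z * Complex.exp w) := hmulC (hz' z) (hz' w)

theorem cw_series (t : ℝ) (n : ℤ) (k : ℝ) :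
    HasSum (fun q : ℕ × ℕ => (cw t q : ℂ) *
        Complex.exp (((n + q.1 - q.2 : ℤ) : ℂ) * Complex.I * k))
      (Complex.exp ((n : ℂ) * Complex.I * k) * (Real.exp (-(t * (2 - 2 * Real.cos k))) : ℂ)) := by
  have h3 := (hz2 (t * Complex.exp (Complex.I * k)) (t * Complex.exp (-(Complex.I * k)))).mul_left
    (Complex.exp ((n : ℂ) * Complex.I * k) * (Real.exp (-(2 * t)) : ℂ))
  have e1 : ∀ q : ℕ × ℕ, (cw t q : ℂ) *
        Complex.exp (((n + q.1 - q.2 : ℤ) : ℂ) * Complex.I * k) =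
      Complex.exp ((n : ℂ) * Complex.I * k) * (Real.exp (-(2 * t)) : ℂ) *
        (exT (t * Complex.exp (Complex.I * k)) q.1 * exT (t * Complex.exp (-(Complex.I * k))) q.2) := by
    intro q
    have h4 : Complex.exp (((n + q.1 - q.2 : ℤ) : ℂ) * Complex.I * k) =
        Complex.exp ((n : ℂ) * Complex.I * k) * Complex.exp (Complex.I * k) ^ q.1
          * Complex.exp (-(Complex.I * k)) ^ q.2 := by
      rw [← Complex.exp_nat_mul, ← Complex.exp_nat_mul, ← Complex.exp_add, ← Complex.exp_add]
      congr 1; push_cast; ring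
    have h5 : (cw t q : ℂ) = (Real.exp (-(2 * t)) : ℂ) *
        (((t : ℂ) ^ q.1 / (q.1.factorial : ℂ)) * ((t : ℂ) ^ q.2 / (q.2.factorial : ℂ))) := by
      simp only [cw, Complex.ofReal_mul, Complex.ofReal_div, Complex.ofReal_pow,
        Complex.ofReal_natCast]
    unfold exT
    rw [h4, h5, mul_pow, mul_pow]
    generalize Complex.exp ((n : ℂ) * Complex.I * k) = A
    generalize Complex.exp (Complex.I * k) ^ q.1 = B
    generalize Complex.exp (-(Complex.I * k)) ^ q.2 = B'
    ring
  have e2 : Complex.exp ((n : ℂ) * Complex.I * k) * (Real.exp (-(t * (2 - 2 * Real.cos k))) : ℂ) =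
      Complex.exp ((n : ℂ) * Complex.I * k) * (Real.exp (-(2 * t)) : ℂ) *
        (Complex.exp (t * Complex.exp (Complex.I * k)) *
          Complex.exp (t * Complex.exp (-(Complex.I * k)))) := by
    rw [mul_assoc (Complex.exp ((n : ℂ) * Complex.I * k))]
    congr 1
    rw [← Complex.exp_add, Complex.ofReal_exp, Complex.ofReal_exp, ← Complex.exp_add]
    congr 1
    push_cast
    rw [Complex.cos]
    rw [show (-(k:ℂ) * Complex.I) = -(Complex.I * k) by ring,
      show ((k:ℂ) * Complex.I) = (Complex.I * k) by ring]
    ring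
  rw [e2]
  rw [funext e1]
  exact h3

/-- One-dimensional heat kernel. -/
def rk (t : ℝ) (n : ℤ) : ℝ := ∑' q : ℕ × ℕ, if n + q.1 - q.2 = 0 then cw t q else 0

theorem rk_hasSum {t : ℝ} (ht : 0 ≤ t) (n : ℤ) :
    HasSum (fun q : ℕ × ℕ => if n + q.1 - q.2 = 0 then cw t q else 0) (rk t n) := by
  apply Summable.hasSum
  refine Summable.of_nonneg_of_le ?_ ?_ (cw_hasSum t).summable
  · intro q; split_ifs; exacts [cw_nonneg ht q, le_rfl]
  · intro q; split_ifs; exacts [le_rfl, cw_nonneg ht q]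

theorem rk_nonneg {t : ℝ} (ht : 0 ≤ t) (n : ℤ) : 0 ≤ rk t n := by
  refine tsum_nonneg ?_
  intro q; split_ifs; exacts [cw_nonneg ht q, le_rfl]

theorem rk_sum_le {t : ℝ} (ht : 0 ≤ t) (S : Finset ℤ) : ∑ n ∈ S, rk t n ≤ 1 := by
  refine hasSum_le ?_ (hasSum_sum fun n (_ : n ∈ S) => rk_hasSum ht n) (cw_hasSum t)
  intro q
  have : ∀ n : ℤ, (n + q.1 - q.2 = 0) ↔ ((q.2 : ℤ) - q.1 = n) := fun n => by omega
  simp only [this]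
  rw [Finset.sum_ite_eq]
  split_ifs; exacts [le_rfl, cw_nonneg ht q]

theorem rk_integral {t : ℝ} (ht : 0 ≤ t) (n : ℤ) :
    ∫ k in Set.Icc (0 : ℝ) (2 * Real.pi),
      Complex.exp ((n : ℂ) * Complex.I * k) * (Real.exp (-(t * (2 - 2 * Real.cos k))) : ℂ)
      = ((2 * Real.pi * rk t n : ℝ) : ℂ) := by
  rw [integral_Icc_eq_integral_Ioc, ← intervalIntegral.integral_of_le (by positivity)]
  have key := intervalIntegral.hasSum_integral_of_dominated_convergence (μ := volume)
    (a := 0) (b := 2 * Real.pi)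
    (F := fun (q : ℕ × ℕ) (k : ℝ) => (cw t q : ℂ) *
        Complex.exp (((n + q.1 - q.2 : ℤ) : ℂ) * Complex.I * k))
    (f := fun k : ℝ => Complex.exp ((n : ℂ) * Complex.I * k) * (Real.exp (-(t * (2 - 2 * Real.cos k))) : ℂ))
    (fun q _ => cw t q)
    (fun q => by
      apply Continuous.aestronglyMeasurable
      fun_prop)
    (fun q => by
      refine Filter.Eventually.of_forall fun k _ => ?_
      rw [norm_mul, Complex.norm_real, Real.norm_of_nonneg (cw_nonneg ht q)]
      have : (((n + q.1 - q.2 : ℤ) : ℂ) * Complex.I * k) = (((n + q.1 - q.2 : ℤ) * k : ℝ) : ℂ) * Complex.I := by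
        push_cast; ring
      rw [this, Complex.norm_exp_ofReal_mul_I, mul_one])
    (Filter.Eventually.of_forall fun k _ => (cw_hasSum t).summable)
    (by simp)
    (Filter.Eventually.of_forall fun k _ => cw_series t n k)
  have h2 := (Complex.hasSum_ofReal.2 ((rk_hasSum ht n).mul_left (2 * Real.pi)))
  refine key.unique ?_
  convert! h2 using 1
  ext q
  rw [intervalIntegral.integral_const_mul, int_exp_orth]
  split_ifs
  · push_cast; ring
  · simp

theorem one_sub_cos_ge {x : ℝ} (hx : |x| ≤ Real.pi) : (4 / Real.pi ^ 2) * x ^ 2 ≤ 2 - 2 * Real.cos x := by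
  have := Real.cos_le_one_sub_mul_cos_sq hx
  have e : (4 / Real.pi ^ 2) * x ^ 2 = 2 * (2 / Real.pi ^ 2 * x ^ 2) := by ring
  linarith

def mt (t : ℝ) : ℝ := min 1 (t ^ (-(1 / 2) : ℝ))

theorem heat1_bound : ∃ D : ℝ, 1 ≤ D ∧ ∀ t : ℝ, 0 < t →
    ∫ k in Set.Icc (0 : ℝ) (2 * Real.pi), Real.exp (-(t * (2 - 2 * Real.cos k)))
      ≤ 2 * Real.pi * (D * mt t) := by
  refine ⟨Real.pi * Real.pi + 1, by nlinarith [Real.pi_pos], fun t ht => ?_⟩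
  have hpi := Real.pi_pos
  have hExpInt : IntegrableOn (fun k : ℝ => Real.exp (-(t * (2 - 2 * Real.cos k))))
      (Set.Icc (0 : ℝ) (2 * Real.pi)) :=
    (Continuous.continuousOn (by fun_prop)).integrableOn_Icc
  have b1 : ∫ k in Set.Icc (0 : ℝ) (2 * Real.pi), Real.exp (-(t * (2 - 2 * Real.cos k)))
      ≤ 2 * Real.pi := by
    have : ∫ k in Set.Icc (0 : ℝ) (2 * Real.pi), (1 : ℝ) = 2 * Real.pi := by
      simp [hpi.le]
    refine le_of_le_of_eq ?_ this
    refine setIntegral_mono_on hExpInt continuous_const.continuousOn.integrableOn_Icc measurableSet_Icc fun k _ => ?_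
    rw [Real.exp_le_one_iff]
    have := Real.cos_le_one k
    nlinarith
  set b := t * (4 / Real.pi ^ 2) with hb
  have hbpos : 0 < b := by positivity
  have g1 := integrable_exp_neg_mul_sq hbpos
  have g2 : Integrable (fun x : ℝ => Real.exp (-b * (2 * Real.pi - x) ^ 2)) :=
    g1.comp_sub_left (2 * Real.pi)
  have b2 : ∫ k in Set.Icc (0 : ℝ) (2 * Real.pi), Real.exp (-(t * (2 - 2 * Real.cos k)))
      ≤ 2 * √(Real.pi / b) := by
    calc _ ≤ ∫ k in Set.Icc (0 : ℝ) (2 * Real.pi),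
          (Real.exp (-b * k ^ 2) + Real.exp (-b * (2 * Real.pi - k) ^ 2)) := by
          refine setIntegral_mono_on hExpInt (g1.add g2).integrableOn measurableSet_Icc fun k hk => ?_
          rcases le_total k Real.pi with h | h
          · have := one_sub_cos_ge (x := k) (by rw [abs_of_nonneg hk.1]; exact h)
            have h2 : Real.exp (-(t * (2 - 2 * Real.cos k))) ≤ Real.exp (-b * k ^ 2) := by
              rw [Real.exp_le_exp, hb]
              nlinarith [mul_le_mul_of_nonneg_left this ht.le]
            linarith [Real.exp_pos (-b * (2 * Real.pi - k) ^ 2)]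
          · have := one_sub_cos_ge (x := 2 * Real.pi - k)
              (by rw [abs_of_nonneg (by linarith [hk.2])]; linarith)
            rw [Real.cos_two_pi_sub] at this
            have h2 : Real.exp (-(t * (2 - 2 * Real.cos k))) ≤ Real.exp (-b * (2 * Real.pi - k) ^ 2) := by
              rw [Real.exp_le_exp, hb]
              nlinarith [mul_le_mul_of_nonneg_left this ht.le]
            linarith [Real.exp_pos (-b * k ^ 2)]
      _ ≤ ∫ k, (Real.exp (-b * k ^ 2) + Real.exp (-b * (2 * Real.pi - k) ^ 2)) :=
          setIntegral_le_integral (g1.add g2) (Filter.Eventually.of_forall fun k => by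
            simp only [Pi.zero_apply]; positivity)
      _ = 2 * √(Real.pi / b) := by
          rw [integral_add g1 g2, integral_sub_left_eq_self (fun x : ℝ => Real.exp (-b * x ^ 2)),
            integral_gaussian]; ring
  have e1 : √(Real.pi / b) = √Real.pi * Real.pi / 2 * t ^ (-(1 / 2) : ℝ) := by
    have : Real.pi / b = (√Real.pi * Real.pi / 2 * t ^ (-(1 / 2) : ℝ)) ^ 2 := by
      rw [mul_pow, ← Real.rpow_natCast (t ^ _), ← Real.rpow_mul ht.le]
      have : ((-(1 / 2) : ℝ) * ((2 : ℕ) : ℝ)) = -1 := by norm_num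
      rw [this, Real.rpow_neg_one, div_pow, mul_pow, Real.sq_sqrt hpi.le, hb]
      field_simp
      ring
    rw [this, Real.sqrt_sq (by positivity)]
  rw [e1] at b2
  have hs : √Real.pi ≤ Real.pi := by
    rw [Real.sqrt_le_left hpi.le]; nlinarith [Real.pi_gt_three]
  unfold mt
  rcases min_cases (1 : ℝ) (t ^ (-(1 / 2) : ℝ)) with ⟨h, _⟩ | ⟨h, _⟩ <;> rw [h]
  · nlinarith
  · have hT : 0 < t ^ (-(1 / 2) : ℝ) := by positivity
    refine b2.trans ?_
    have : √Real.pi * Real.pi ≤ Real.pi * Real.pi := by gcongr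
    calc 2 * (√Real.pi * Real.pi / 2 * t ^ (-(1 / 2) : ℝ))
        = (√Real.pi * Real.pi) * t ^ (-(1 / 2) : ℝ) := by ring
      _ ≤ (2 * Real.pi * (Real.pi * Real.pi + 1)) * t ^ (-(1 / 2) : ℝ) := by
          refine mul_le_mul_of_nonneg_right ?_ hT.le
          nlinarith [Real.pi_gt_three, mul_pos hpi hpi]
      _ = _ := by ring

theorem rk_le {D t : ℝ} (ht : 0 < t)
    (hD : ∫ k in Set.Icc (0 : ℝ) (2 * Real.pi), Real.exp (-(t * (2 - 2 * Real.cos k)))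
      ≤ 2 * Real.pi * (D * mt t)) (n : ℤ) : rk t n ≤ D * mt t := by
  have h := congrArg norm (rk_integral ht.le n)
  rw [Complex.norm_real, Real.norm_of_nonneg (mul_nonneg (by positivity) (rk_nonneg ht.le n))] at h
  have h2 : 2 * Real.pi * rk t n ≤ 2 * Real.pi * (D * mt t) := by
    rw [← h]
    refine (norm_integral_le_integral_norm _).trans (le_trans (le_of_eq ?_) hD)
    refine integral_congr_ae (Filter.Eventually.of_forall fun k => ?_)
    have : ((n : ℂ) * Complex.I * k) = ((n * k : ℝ) : ℂ) * Complex.I := by push_cast; ring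
    simp only [norm_mul]
    rw [this, Complex.norm_exp_ofReal_mul_I, one_mul, Complex.norm_real,
      Real.norm_of_nonneg (Real.exp_pos _).le]
  exact le_of_mul_le_mul_left h2 (by positivity)

/-- The `d`-dimensional heat kernel. -/
def pk (t : ℝ) (z : Z d) : ℝ := ∏ i, rk t (z i)

theorem pk_nonneg {t : ℝ} (ht : 0 ≤ t) (z : Z d) : 0 ≤ pk t z :=
  Finset.prod_nonneg fun i _ => rk_nonneg ht _

theorem pk_le {D t : ℝ} (ht : 0 < t)
    (hD : ∫ k in Set.Icc (0 : ℝ) (2 * Real.pi), Real.exp (-(t * (2 - 2 * Real.cos k)))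
      ≤ 2 * Real.pi * (D * mt t)) (z : Z d) : pk t z ≤ (D * mt t) ^ d := by
  calc pk t z ≤ ∏ _i : Fin d, (D * mt t) :=
        Finset.prod_le_prod (fun i _ => rk_nonneg ht.le _) (fun i _ => rk_le ht hD _)
    _ = _ := by simp

theorem pk_sum_le {t : ℝ} (ht : 0 ≤ t) (S : Finset (Z d)) : ∑ z ∈ S, pk t z ≤ 1 := by
  classical
  let T : Finset ℤ := S.biUnion fun z => Finset.univ.image z
  have hsub : S ⊆ Fintype.piFinset fun _ : Fin d => T := by
    intro z hz
    rw [Fintype.mem_piFinset]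
    intro i
    exact Finset.mem_biUnion.2 ⟨z, hz, Finset.mem_image_of_mem _ (Finset.mem_univ i)⟩
  calc ∑ z ∈ S, pk t z ≤ ∑ z ∈ Fintype.piFinset fun _ : Fin d => T, pk t z :=
        Finset.sum_le_sum_of_subset_of_nonneg hsub fun z _ _ => pk_nonneg ht z
    _ = ∏ _i : Fin d, ∑ n ∈ T, rk t n := Finset.sum_prod_piFinset T (fun _ n => rk t n)
    _ ≤ 1 := Finset.prod_le_one (fun _ _ => Finset.sum_nonneg fun n _ => rk_nonneg ht n)
        (fun _ _ => rk_sum_le ht T)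

theorem muk_eq (k : Fin d → ℝ) : muk d k = ∑ j, (2 - 2 * Real.cos (k j)) := by
  rw [Finset.sum_sub_distrib, ← Finset.mul_sum]
  simp [muk]; ring

theorem muk_nonneg (k : Fin d → ℝ) : 0 ≤ muk d k := by
  rw [muk_eq]
  exact Finset.sum_nonneg fun j _ => by linarith [Real.cos_le_one (k j)]

theorem box_restrict : (volume : Measure (Fin d → ℝ)).restrict (box d) =
    Measure.pi fun _ : Fin d => (volume : Measure ℝ).restrict (Set.Icc 0 (2 * Real.pi)) := by
  rw [box, volume_pi, Measure.restrict_pi_pi]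

theorem box_exp (t : ℝ) : ∫ k in box d, Real.exp (-(t * muk d k)) =
    (∫ k in Set.Icc (0 : ℝ) (2 * Real.pi), Real.exp (-(t * (2 - 2 * Real.cos k)))) ^ d := by
  have : ∀ k : Fin d → ℝ, Real.exp (-(t * muk d k)) =
      ∏ j, Real.exp (-(t * (2 - 2 * Real.cos (k j)))) := by
    intro k
    rw [← Real.exp_sum, muk_eq, Finset.mul_sum, Finset.sum_neg_distrib]
  simp_rw [this]
  rw [box_restrict]
  rw [integral_fintype_prod_eq_prod (fun (_ : Fin d) (x : ℝ) => Real.exp (-(t * (2 - 2 * Real.cos x))))]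
  simp

theorem muk_cont : Continuous (muk d) := by
  unfold muk; fun_prop

theorem box_compact : IsCompact (box d) := isCompact_univ_pi fun _ => isCompact_Icc

theorem box_cos {t : ℝ} (ht : 0 ≤ t) (z : Z d) :
    ∫ k in box d, Real.cos (∑ j, ((z j : ℤ) : ℝ) * k j) * Real.exp (-(t * muk d k)) =
      (2 * Real.pi) ^ d * pk t z := by
  have h1 : ∀ k : Fin d → ℝ, Real.cos (∑ j, ((z j : ℤ) : ℝ) * k j) * Real.exp (-(t * muk d k)) =
      RCLike.re (∏ j, (Complex.exp ((z j : ℂ) * Complex.I * k j) *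
        (Real.exp (-(t * (2 - 2 * Real.cos (k j)))) : ℂ))) := by
    intro k
    rw [Finset.prod_mul_distrib, ← Complex.exp_sum, ← Complex.ofReal_prod, ← Real.exp_sum]
    have e1 : ∑ j, (z j : ℂ) * Complex.I * k j = ((∑ j, ((z j : ℤ) : ℝ) * k j : ℝ) : ℂ) * Complex.I := by
      push_cast
      rw [Finset.sum_mul]
      exact Finset.sum_congr rfl fun j _ => by ring
    rw [e1, muk_eq, Finset.mul_sum, Finset.sum_neg_distrib]
    simp only [RCLike.re_eq_complex_re]
    rw [Complex.re_mul_ofReal, Complex.exp_ofReal_mul_I_re]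
  simp_rw [h1]
  have hc : IntegrableOn (fun k : Fin d → ℝ => ∏ j, (Complex.exp ((z j : ℂ) * Complex.I * k j) *
        (Real.exp (-(t * (2 - 2 * Real.cos (k j)))) : ℂ))) (box d) volume :=
    ContinuousOn.integrableOn_compact box_compact (Continuous.continuousOn (by fun_prop))
  rw [integral_re hc, box_restrict]
  rw [integral_fintype_prod_eq_prod (fun (j : Fin d) (x : ℝ) => Complex.exp ((z j : ℂ) * Complex.I * x) *
        (Real.exp (-(t * (2 - 2 * Real.cos x))) : ℂ))]
  simp_rw [rk_integral ht]
  rw [← Complex.ofReal_prod]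
  simp only [RCLike.re_eq_complex_re, Complex.ofReal_re]
  rw [Finset.prod_mul_distrib]
  simp [pk]

theorem mt_nonneg {t : ℝ} (ht : 0 < t) : 0 ≤ mt t := by unfold mt; positivity

theorem mt_le_one (t : ℝ) : mt t ≤ 1 := min_le_left _ _

theorem mt_integrable {a b : ℝ} (ha : 0 < a) (hb : 2 * a < b) :
    IntegrableOn (fun t : ℝ => t ^ (a - 1) * mt t ^ b) (Set.Ioi 0) := by
  have hmeas : Measurable fun t : ℝ => t ^ (a - 1) * mt t ^ b := by
    unfold mt; fun_prop
  rw [← Set.Ioc_union_Ioi_eq_Ioi (zero_le_one : (0 : ℝ) ≤ 1)]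
  refine IntegrableOn.union ?_ ?_
  · have h1 : IntegrableOn (fun t : ℝ => t ^ (a - 1)) (Set.Ioc 0 1) := by
      have := intervalIntegral.intervalIntegrable_rpow' (a := 0) (b := 1) (r := a - 1) (by linarith)
      rwa [intervalIntegrable_iff_integrableOn_Ioc_of_le zero_le_one] at this
    refine Integrable.mono' h1 hmeas.aestronglyMeasurable ?_
    refine (ae_restrict_iff' measurableSet_Ioc).2 (Filter.Eventually.of_forall fun t ht => ?_)
    have hm := mt_nonneg ht.1
    have hp : 0 ≤ t ^ (a - 1) := Real.rpow_nonneg ht.1.le _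
    rw [Real.norm_of_nonneg (mul_nonneg hp (Real.rpow_nonneg hm _))]
    exact mul_le_of_le_one_right hp (Real.rpow_le_one hm (mt_le_one t) (by linarith))
  · have h1 : IntegrableOn (fun t : ℝ => t ^ (a - 1 - b / 2)) (Set.Ioi 1) :=
      integrableOn_Ioi_rpow_of_lt (by linarith) zero_lt_one
    refine Integrable.mono' h1 hmeas.aestronglyMeasurable ?_
    refine (ae_restrict_iff' measurableSet_Ioi).2 (Filter.Eventually.of_forall fun t ht => ?_)
    have ht0 : 0 < t := lt_trans zero_lt_one ht
    have hm := mt_nonneg ht0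
    have hp : 0 ≤ t ^ (a - 1) := Real.rpow_nonneg ht0.le _
    rw [Real.norm_of_nonneg (mul_nonneg hp (Real.rpow_nonneg hm _))]
    have : mt t ^ b ≤ (t ^ (-(1 / 2) : ℝ)) ^ b :=
      Real.rpow_le_rpow hm (min_le_right _ _) (by linarith)
    calc t ^ (a - 1) * mt t ^ b ≤ t ^ (a - 1) * (t ^ (-(1 / 2) : ℝ)) ^ b := by gcongr
      _ = t ^ (a - 1 - b / 2) := by
        rw [← Real.rpow_mul ht0.le, ← Real.rpow_add ht0]; congr 1; ring

theorem muk_pos_ae (hd : 0 < d) : ∀ᵐ k ∂(volume : Measure (Fin d → ℝ)).restrict (box d),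
    0 < muk d k := by
  have : Nonempty (Fin d) := ⟨⟨0, hd⟩⟩
  have hm : MeasurableSet (box d) := box_compact.isClosed.measurableSet
  rw [ae_restrict_iff' hm]
  have hfin : (Set.univ.pi fun _ : Fin d => ({0, 2 * Real.pi} : Set ℝ)).Finite :=
    Set.Finite.pi fun _ => Set.toFinite _
  have h0 : (volume : Measure (Fin d → ℝ)) (Set.univ.pi fun _ : Fin d => ({0, 2 * Real.pi} : Set ℝ)) = 0 :=
    hfin.measure_zero _
  have h1 : ∀ᵐ k ∂(volume : Measure (Fin d → ℝ)),
    k ∉ (Set.univ.pi fun _ : Fin d => ({0, 2 * Real.pi} : Set ℝ)) := measure_eq_zero_iff_ae_notMem.1 h0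
  filter_upwards [h1] with k hk hkb
  refine lt_of_le_of_ne (muk_nonneg k) fun h => hk ?_
  rw [muk_eq] at h
  have h2 := (Finset.sum_eq_zero_iff_of_nonneg
    (fun j _ => by linarith [Real.cos_le_one (k j)])).1 h.symm
  intro j _
  have hc : Real.cos (k j) = 1 := by linarith [h2 j (Finset.mem_univ j)]
  have hkj := hkb j (Set.mem_univ j)
  rw [Set.mem_Icc] at hkj
  by_cases h2p : k j = 2 * Real.pi
  · right; exact h2p
  · left
    exact (Real.cos_eq_one_iff_of_lt_of_lt (by linarith [hkj.1, Real.pi_pos])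
      (lt_of_le_of_ne hkj.2 h2p)).1 hc

theorem fubini_int {a : ℝ} (ha : 0 < a) (had : 2 * a < d) (z : Z d) :
    Integrable (Function.uncurry fun (k : Fin d → ℝ) (t : ℝ) =>
      Real.cos (∑ j, ((z j : ℤ) : ℝ) * k j) * (t ^ (a - 1) * Real.exp (-(muk d k * t))))
      (((volume : Measure (Fin d → ℝ)).restrict (box d)).prod
        ((volume : Measure ℝ).restrict (Set.Ioi 0))) := by
  obtain ⟨D, hD1, hD⟩ := heat1_bound
  have : IsFiniteMeasure ((volume : Measure (Fin d → ℝ)).restrict (box d)) :=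
    ⟨by rw [Measure.restrict_apply_univ]; exact box_compact.measure_lt_top⟩
  have hmeas : Measurable (Function.uncurry fun (k : Fin d → ℝ) (t : ℝ) =>
      Real.cos (∑ j, ((z j : ℤ) : ℝ) * k j) * (t ^ (a - 1) * Real.exp (-(muk d k * t)))) := by
    have := (muk_cont (d := d)).measurable
    unfold Function.uncurry
    fun_prop
  rw [integrable_prod_iff' hmeas.aestronglyMeasurable]
  have hcont : ∀ t : ℝ, IntegrableOn (fun k : Fin d → ℝ => Real.cos (∑ j, ((z j : ℤ) : ℝ) * k j)
      * (t ^ (a - 1) * Real.exp (-(muk d k * t)))) (box d) := fun t =>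
    ContinuousOn.integrableOn_compact box_compact (Continuous.continuousOn (by
      have := muk_cont (d := d)
      fun_prop))
  refine ⟨Filter.Eventually.of_forall fun t => hcont t, ?_⟩
  have hI := (mt_integrable (a := a) (b := d) ha had).const_mul ((2 * Real.pi * D) ^ d)
  refine Integrable.mono' hI ?_ ?_
  · exact hmeas.aestronglyMeasurable.prod_swap.norm.integral_prod_right'
  · refine (ae_restrict_iff' measurableSet_Ioi).2 (Filter.Eventually.of_forall fun t ht => ?_)
    have ht0 : 0 < t := ht
    rw [Real.norm_of_nonneg (integral_nonneg fun k => norm_nonneg _)]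
    have hE : IntegrableOn (fun k : Fin d → ℝ => Real.exp (-(t * muk d k))) (box d) :=
      ContinuousOn.integrableOn_compact box_compact (Continuous.continuousOn (by
        have := muk_cont (d := d)
        fun_prop))
    calc _ ≤ ∫ k in box d, t ^ (a - 1) * Real.exp (-(t * muk d k)) := by
          refine integral_mono_ae (hcont t).norm (hE.const_mul _) (Filter.Eventually.of_forall fun k => ?_)
          have hp : 0 ≤ t ^ (a - 1) * Real.exp (-(muk d k * t)) := by positivity
          simp only [Function.uncurry]
          rw [norm_mul, Real.norm_of_nonneg hp, Real.norm_eq_abs, mul_comm t (muk d k)]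
          exact mul_le_of_le_one_left hp (Real.abs_cos_le_one _)
      _ = t ^ (a - 1) * (∫ k in Set.Icc (0 : ℝ) (2 * Real.pi), Real.exp (-(t * (2 - 2 * Real.cos k)))) ^ d := by
          rw [integral_const_mul, box_exp]
      _ ≤ t ^ (a - 1) * (2 * Real.pi * (D * mt t)) ^ d := by
          gcongr
          exact hD t ht0
      _ = (2 * Real.pi * D) ^ d * (t ^ (a - 1) * mt t ^ (d : ℝ)) := by
          rw [Real.rpow_natCast, ← mul_assoc, mul_pow]; ring

theorem box_muk_rpow (hd : 0 < d) {a : ℝ} (ha : 0 < a) (had : 2 * a < d) (z : Z d) :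
    (∫ k in box d, Real.cos (∑ j, ((z j : ℤ) : ℝ) * k j) * muk d k ^ (-a)) =
      (Real.Gamma a)⁻¹ * (2 * Real.pi) ^ d * ∫ t in Set.Ioi (0 : ℝ), t ^ (a - 1) * pk t z := by
  have hG : Real.Gamma a ≠ 0 := (Real.Gamma_pos_of_pos ha).ne'
  have h1 : (∫ k in box d, Real.cos (∑ j, ((z j : ℤ) : ℝ) * k j) * muk d k ^ (-a)) =
      (Real.Gamma a)⁻¹ * ∫ k in box d, ∫ t in Set.Ioi (0 : ℝ),
        Real.cos (∑ j, ((z j : ℤ) : ℝ) * k j) * (t ^ (a - 1) * Real.exp (-(muk d k * t))) := by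
    rw [← integral_const_mul]
    refine integral_congr_ae ?_
    filter_upwards [muk_pos_ae hd] with k hk
    rw [integral_const_mul, Real.integral_rpow_mul_exp_neg_mul_Ioi ha hk, one_div,
      Real.inv_rpow hk.le, ← Real.rpow_neg hk.le]
    field_simp
  rw [h1, integral_integral_swap (fubini_int ha had z), mul_assoc]
  congr 1
  rw [← integral_const_mul]
  refine setIntegral_congr_fun measurableSet_Ioi fun t ht => ?_
  have ht0 : 0 ≤ t := le_of_lt ht
  have := box_cos ht0 z
  calc _ = ∫ k in box d, t ^ (a - 1) * (Real.cos (∑ j, ((z j : ℤ) : ℝ) * k j) * Real.exp (-(t * muk d k))) := by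
        refine integral_congr_ae (Filter.Eventually.of_forall fun k => ?_)
        simp only [mul_comm t (muk d k)]
        ring
    _ = _ := by
        rw [integral_const_mul, this]; ring

theorem pk_integrable {a : ℝ} (ha : 0 < a) (had : 2 * a < d) (z : Z d) :
    IntegrableOn (fun t : ℝ => t ^ (a - 1) * pk t z) (Set.Ioi 0) := by
  have h := (fubini_int ha had z).integral_prod_right.const_mul (((2 * Real.pi) ^ d)⁻¹)
  refine h.congr ?_
  refine (ae_restrict_iff' measurableSet_Ioi).2 (Filter.Eventually.of_forall fun t ht => ?_)
  have ht0 : 0 ≤ t := le_of_lt ht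
  have := box_cos ht0 z
  have h2 : ∫ k in box d, Function.uncurry (fun (k : Fin d → ℝ) (t : ℝ) =>
      Real.cos (∑ j, ((z j : ℤ) : ℝ) * k j) * (t ^ (a - 1) * Real.exp (-(muk d k * t)))) (k, t)
      = t ^ (a - 1) * ((2 * Real.pi) ^ d * pk t z) := by
    rw [← this, ← integral_const_mul]
    refine integral_congr_ae (Filter.Eventually.of_forall fun k => ?_)
    simp only [mul_comm t (muk d k), Function.uncurry]
    ring
  simp only [h2]
  have : (2 * Real.pi) ^ d ≠ 0 := by positivity
  field_simp

theorem amgm_pt {γ P w₁ w₂ : ℝ} (h1 : 1 / 2 < γ) (h2 : γ ≤ 1) (hP : 0 ≤ P) (hw₁ : 0 ≤ w₁)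
    (hw₂ : 0 ≤ w₂) : P * (w₁ ^ γ * w₂ ^ γ) ≤ P ^ (2 * γ - 1) *
      ((2 * γ - 1) * (w₁ * w₂) + (1 - γ) * (w₁ * P) + (1 - γ) * (w₂ * P)) := by
  have e : P * (w₁ ^ γ * w₂ ^ γ) = P ^ (2 * γ - 1) *
      ((w₁ * w₂) ^ (2 * γ - 1) * (w₁ * P) ^ (1 - γ) * (w₂ * P) ^ (1 - γ)) := by
    have hP' : P = P ^ (2 * γ - 1) * (P ^ (1 - γ) * P ^ (1 - γ)) := by
      rw [← Real.rpow_add_of_nonneg hP (by linarith) (by linarith),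
        ← Real.rpow_add_of_nonneg hP (by linarith) (by linarith)]
      rw [show 2 * γ - 1 + (1 - γ + (1 - γ)) = 1 by ring, Real.rpow_one]
    have hw : ∀ w : ℝ, 0 ≤ w → w ^ γ = w ^ (2 * γ - 1) * w ^ (1 - γ) := by
      intro w hw
      rw [← Real.rpow_add_of_nonneg hw (by linarith) (by linarith)]
      congr 1; ring
    rw [Real.mul_rpow hw₁ hw₂, Real.mul_rpow hw₁ hP, Real.mul_rpow hw₂ hP, hw w₁ hw₁, hw w₂ hw₂]
    nth_rewrite 1 [hP']
    ring
  rw [e]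
  gcongr
  exact Real.geom_mean_le_arith_mean3_weighted (by linarith) (by linarith) (by linarith)
    (mul_nonneg hw₁ hw₂) (mul_nonneg hw₁ hP) (mul_nonneg hw₂ hP) (by ring)

theorem sum_pair_le {w : Z d → ℝ} (hw : ∀ x, 0 ≤ w x) (hs : ∀ S : Finset (Z d), ∑ x ∈ S, w x ≤ 1)
    {g : Z d → Z d → ℝ} (hg : ∀ x y, 0 ≤ g x y)
    (hgs : ∀ (x : Z d) (S : Finset (Z d)), ∑ y ∈ S, g x y ≤ 1) (T : Finset (Z d × Z d)) :
    ∑ q ∈ T, w q.1 * g q.1 q.2 ≤ 1 := by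
  classical
  calc ∑ q ∈ T, w q.1 * g q.1 q.2 ≤ ∑ q ∈ T.image Prod.fst ×ˢ T.image Prod.snd, w q.1 * g q.1 q.2 :=
        Finset.sum_le_sum_of_subset_of_nonneg (Finset.subset_product)
          fun q _ _ => mul_nonneg (hw _) (hg _ _)
    _ = ∑ x ∈ T.image Prod.fst, w x * ∑ y ∈ T.image Prod.snd, g x y := by
        rw [Finset.sum_product]
        exact Finset.sum_congr rfl fun x _ => by rw [Finset.mul_sum]
    _ ≤ ∑ x ∈ T.image Prod.fst, w x := Finset.sum_le_sum fun x _ =>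
        mul_le_of_le_one_right (hw x) (hgs x _)
    _ ≤ 1 := hs _

theorem pk_sum_le_left {t : ℝ} (ht : 0 ≤ t) (x : Z d) (S : Finset (Z d)) :
    ∑ y ∈ S, pk t (x - y) ≤ 1 := by
  classical
  have := pk_sum_le ht (S.image fun y => x - y)
  rwa [Finset.sum_image (fun a _ b _ h => sub_right_injective h)] at this

theorem pk_sum_le_right {t : ℝ} (ht : 0 ≤ t) (x : Z d) (S : Finset (Z d)) :
    ∑ y ∈ S, pk t (y - x) ≤ 1 := by
  classical
  have := pk_sum_le ht (S.image fun y => y - x)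
  rwa [Finset.sum_image (fun a _ b _ h => sub_left_injective h)] at this

theorem heat_form {γ t B : ℝ} (h1 : 1 / 2 < γ) (h2 : γ ≤ 1) (ht : 0 ≤ t)
    (hB : ∀ z : Z d, pk t z ≤ B) {w : Z d → ℝ} (hw : ∀ x, 0 ≤ w x)
    (hs : ∀ S : Finset (Z d), ∑ x ∈ S, w x ≤ 1) (T : Finset (Z d × Z d)) :
    ∑ q ∈ T, pk t (q.1 - q.2) * (w q.1 ^ γ * w q.2 ^ γ) ≤ B ^ (2 * γ - 1) := by
  classical
  have hB0 : 0 ≤ B := (pk_nonneg ht 0).trans (hB 0)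
  have s1 : ∑ q ∈ T, w q.1 * w q.2 ≤ 1 :=
    sum_pair_le hw hs (g := fun _ y => w y) (fun _ y => hw y) (fun _ S => hs S) T
  have s2 : ∑ q ∈ T, w q.1 * pk t (q.1 - q.2) ≤ 1 :=
    sum_pair_le hw hs (g := fun x y => pk t (x - y)) (fun _ _ => pk_nonneg ht _)
      (fun x S => pk_sum_le_left ht x S) T
  have s3 : ∑ q ∈ T, w q.2 * pk t (q.1 - q.2) ≤ 1 := by
    have := sum_pair_le hw hs (g := fun x y => pk t (y - x)) (fun _ _ => pk_nonneg ht _)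
      (fun x S => pk_sum_le_right ht x S) (T.image Prod.swap)
    rwa [Finset.sum_image (fun a _ b _ h => Prod.swap_injective h)] at this
  calc ∑ q ∈ T, pk t (q.1 - q.2) * (w q.1 ^ γ * w q.2 ^ γ)
      ≤ ∑ q ∈ T, B ^ (2 * γ - 1) * ((2 * γ - 1) * (w q.1 * w q.2) +
          (1 - γ) * (w q.1 * pk t (q.1 - q.2)) + (1 - γ) * (w q.2 * pk t (q.1 - q.2))) := by
        refine Finset.sum_le_sum fun q _ => ?_
        have hP := pk_nonneg ht (q.1 - q.2)
        refine (amgm_pt h1 h2 hP (hw q.1) (hw q.2)).trans ?_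
        refine mul_le_mul_of_nonneg_right (Real.rpow_le_rpow hP (hB _) (by linarith)) ?_
        have a1 := mul_nonneg (hw q.1) (hw q.2)
        have a2 := mul_nonneg (hw q.1) hP
        have a3 := mul_nonneg (hw q.2) hP
        have b1 : 0 ≤ 2 * γ - 1 := by linarith
        have b2 : 0 ≤ 1 - γ := by linarith
        positivity
    _ = B ^ (2 * γ - 1) * ((2 * γ - 1) * (∑ q ∈ T, w q.1 * w q.2) +
          (1 - γ) * (∑ q ∈ T, w q.1 * pk t (q.1 - q.2)) +
          (1 - γ) * (∑ q ∈ T, w q.2 * pk t (q.1 - q.2))) := by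
        rw [← Finset.mul_sum, Finset.sum_add_distrib, Finset.sum_add_distrib, Finset.mul_sum,
          Finset.mul_sum, Finset.mul_sum]
    _ ≤ B ^ (2 * γ - 1) * 1 := by
        refine mul_le_mul_of_nonneg_left ?_ (Real.rpow_nonneg hB0 _)
        nlinarith
    _ = _ := mul_one _

theorem form_bound (hd : 0 < d) {α : ℝ} (hα : α ∈ Set.Ioo (0 : ℝ) (d : ℝ)) {γ : ℝ}
    (hγ : ((d : ℝ) + α) / (2 * d) < γ) (hγ1 : γ ≤ 1) :
    ∃ A : ℝ, 0 < A ∧ ∀ w : Z d → ℝ, (∀ x, 0 ≤ w x) →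
      (∀ S : Finset (Z d), ∑ x ∈ S, w x ≤ 1) → ∀ T : Finset (Z d × Z d),
      ∑ q ∈ T, |Riesz d α q.1 q.2| * (w q.1 ^ γ * w q.2 ^ γ) ≤ A := by
  obtain ⟨D, hD1, hD⟩ := heat1_bound
  have hd0 : (0 : ℝ) < d := by exact_mod_cast hd
  have ha : 0 < α / 2 := by linarith [hα.1]
  have had : 2 * (α / 2) < (d : ℝ) := by linarith [hα.2]
  have hγd : (d : ℝ) + α < γ * (2 * d) := by rwa [div_lt_iff₀ (by positivity)] at hγ
  have hγ0 : 1 / 2 < γ := by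
    by_contra hcon
    have : γ ≤ 1 / 2 := not_lt.1 hcon
    nlinarith [hα.1]
  set K : ℝ := Kfrac d α * (2 * Real.pi) ^ (-(d : ℝ)) *
    ((Real.Gamma (α / 2))⁻¹ * (2 * Real.pi) ^ d) with hK
  have hR : ∀ x y : Z d, Riesz d α x y =
      K * ∫ t in Set.Ioi (0 : ℝ), t ^ (α / 2 - 1) * pk t (x - y) := by
    intro x y
    have := box_muk_rpow hd ha had (x - y)
    simp only [Pi.sub_apply] at this
    rw [Riesz, this, hK]
    ring
  set J : ℝ := ∫ t in Set.Ioi (0 : ℝ), (D ^ d) ^ (2 * γ - 1) *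
    (t ^ (α / 2 - 1) * mt t ^ ((d : ℝ) * (2 * γ - 1))) with hJ
  have hJi : IntegrableOn (fun t : ℝ => (D ^ d) ^ (2 * γ - 1) *
    (t ^ (α / 2 - 1) * mt t ^ ((d : ℝ) * (2 * γ - 1)))) (Set.Ioi 0) :=
    (mt_integrable ha (by nlinarith)).const_mul _
  refine ⟨|K| * |J| + 1, by positivity, fun w hw hs T => ?_⟩
  have hpkI : ∀ q : Z d × Z d, 0 ≤ ∫ t in Set.Ioi (0 : ℝ), t ^ (α / 2 - 1) * pk t (q.1 - q.2) :=
    fun q => setIntegral_nonneg measurableSet_Ioi fun t ht =>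
      mul_nonneg (Real.rpow_nonneg (le_of_lt ht) _) (pk_nonneg (le_of_lt ht) _)
  have hsum : ∑ q ∈ T, (∫ t in Set.Ioi (0 : ℝ), t ^ (α / 2 - 1) * pk t (q.1 - q.2)) *
      (w q.1 ^ γ * w q.2 ^ γ) ≤ J := by
    simp_rw [← integral_mul_const]
    rw [← integral_finsetSum _ fun q _ => (pk_integrable ha had (q.1 - q.2)).mul_const _]
    refine setIntegral_mono_on
      (integrable_finsetSum _ fun q _ => (pk_integrable ha had (q.1 - q.2)).mul_const _)
      hJi measurableSet_Ioi fun t ht => ?_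
    have ht0 : 0 < t := ht
    have hm := mt_nonneg ht0
    have hf := heat_form hγ0 hγ1 ht0.le (fun z : Z d => pk_le ht0 (hD t ht0) z) hw hs T
    have e1 : ((D * mt t) ^ d) ^ (2 * γ - 1) =
        (D ^ d) ^ (2 * γ - 1) * mt t ^ ((d : ℝ) * (2 * γ - 1)) := by
      rw [mul_pow, Real.mul_rpow (by positivity) (by positivity), Real.rpow_mul hm,
        Real.rpow_natCast]
    rw [e1] at hf
    calc ∑ q ∈ T, t ^ (α / 2 - 1) * pk t (q.1 - q.2) * (w q.1 ^ γ * w q.2 ^ γ)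
        = t ^ (α / 2 - 1) * ∑ q ∈ T, pk t (q.1 - q.2) * (w q.1 ^ γ * w q.2 ^ γ) := by
          rw [Finset.mul_sum]
          exact Finset.sum_congr rfl fun q _ => by ring
      _ ≤ t ^ (α / 2 - 1) * ((D ^ d) ^ (2 * γ - 1) * mt t ^ ((d : ℝ) * (2 * γ - 1))) := by
          gcongr
      _ = _ := by ring
  calc ∑ q ∈ T, |Riesz d α q.1 q.2| * (w q.1 ^ γ * w q.2 ^ γ)
      = |K| * ∑ q ∈ T, (∫ t in Set.Ioi (0 : ℝ), t ^ (α / 2 - 1) * pk t (q.1 - q.2)) *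
      (w q.1 ^ γ * w q.2 ^ γ) := by
        rw [Finset.mul_sum]
        refine Finset.sum_congr rfl fun q _ => ?_
        rw [hR, abs_mul, abs_of_nonneg (hpkI q), mul_assoc]
    _ ≤ |K| * |J| := by
        gcongr
        exact hsum.trans (le_abs_self J)
    _ ≤ _ := by linarith

theorem g_bound {f : ℝ → ℝ} {p τ C₀ : ℝ} (hf1 : F1 f p) (hC₀ : 0 < C₀) (hτ : 1 ≤ τ)
    (hf2 : ∀ t > (0 : ℝ), f t ≤ C₀ * (1 + t ^ (τ - 1))) {ε : ℝ} (hε : 0 < ε) :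
    ∃ C : ℝ, 0 < C ∧ ∀ v : ℝ, 0 ≤ v → f v * v ≤ ε * v ^ p + C * v ^ τ := by
  obtain ⟨δ, hδ, hδf⟩ := hf1 ε hε
  refine ⟨C₀ * ((δ ^ (τ - 1))⁻¹ + 1), by positivity, fun v hv => ?_⟩
  rcases hv.eq_or_lt with rfl | hv0
  · rw [mul_zero]
    have : (0 : ℝ) ≤ 0 ^ p := Real.rpow_nonneg le_rfl _
    have : (0 : ℝ) ≤ 0 ^ τ := Real.rpow_nonneg le_rfl _
    positivity
  have hvp : v ^ p = v ^ (p - 1) * v := by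
    rw [← Real.rpow_add_one hv0.ne']; congr 1; ring
  have hvτ : v ^ τ = v ^ (τ - 1) * v := by
    rw [← Real.rpow_add_one hv0.ne']; congr 1; ring
  have q1 : 0 ≤ v ^ (p - 1) := Real.rpow_nonneg hv _
  have q2 : 0 ≤ v ^ (τ - 1) := Real.rpow_nonneg hv _
  have main : f v ≤ ε * v ^ (p - 1) + C₀ * ((δ ^ (τ - 1))⁻¹ + 1) * v ^ (τ - 1) := by
    rcases lt_or_ge v δ with h | h
    · have := (le_abs_self _).trans (hδf v hv0 h)
      have : 0 ≤ C₀ * ((δ ^ (τ - 1))⁻¹ + 1) * v ^ (τ - 1) := by positivity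
      linarith
    · have h3 : δ ^ (τ - 1) ≤ v ^ (τ - 1) := Real.rpow_le_rpow hδ.le h (by linarith)
      have h4 : 1 ≤ (δ ^ (τ - 1))⁻¹ * v ^ (τ - 1) := by
        have : 0 < δ ^ (τ - 1) := by positivity
        rw [inv_mul_eq_div, le_div_iff₀ this]; linarith
      have h5 := hf2 v hv0
      have : C₀ * (1 + v ^ (τ - 1)) ≤ C₀ * ((δ ^ (τ - 1))⁻¹ + 1) * v ^ (τ - 1) := by
        nlinarith
      have : 0 ≤ ε * v ^ (p - 1) := by positivity
      linarith
  rw [hvp, hvτ]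
  nlinarith [mul_le_mul_of_nonneg_right main hv]

theorem conv_bound {α γ A : ℝ}
    {w : Z d → ℝ} (hA : ∀ T : Finset (Z d × Z d),
      ∑ q ∈ T, |Riesz d α q.1 q.2| * (w q.1 ^ γ * w q.2 ^ γ) ≤ A) {B : ℝ} (hB : 0 ≤ B)
    (hw : ∀ x, 0 ≤ w x)
    {a b : Z d → ℝ} (ha0 : ∀ x, 0 ≤ a x) (ha : ∀ x, a x ≤ B * w x ^ γ)
    (hb0 : ∀ x, 0 ≤ b x) (hb : ∀ x, b x ≤ B * w x ^ γ) :
    (Summable fun q : Z d × Z d => Riesz d α q.1 q.2 * a q.2 * b q.1) ∧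
    (∑' x : Z d, conv d α a x * b x) ≤ A * B ^ 2 := by
  have hT : ∀ T : Finset (Z d × Z d), ∑ q ∈ T, |Riesz d α q.1 q.2 * a q.2 * b q.1| ≤ A * B ^ 2 := by
    intro T
    calc ∑ q ∈ T, |Riesz d α q.1 q.2 * a q.2 * b q.1|
        ≤ ∑ q ∈ T, B ^ 2 * (|Riesz d α q.1 q.2| * (w q.1 ^ γ * w q.2 ^ γ)) := by
          refine Finset.sum_le_sum fun q _ => ?_
          rw [abs_mul, abs_mul, abs_of_nonneg (ha0 _), abs_of_nonneg (hb0 _), mul_assoc]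
          have : a q.2 * b q.1 ≤ (B * w q.2 ^ γ) * (B * w q.1 ^ γ) :=
            mul_le_mul (ha _) (hb _) (hb0 _) (mul_nonneg hB (Real.rpow_nonneg (hw _) _))
          calc |Riesz d α q.1 q.2| * (a q.2 * b q.1)
              ≤ |Riesz d α q.1 q.2| * ((B * w q.2 ^ γ) * (B * w q.1 ^ γ)) := by gcongr
            _ = _ := by ring
      _ = B ^ 2 * ∑ q ∈ T, (|Riesz d α q.1 q.2| * (w q.1 ^ γ * w q.2 ^ γ)) := by
          rw [Finset.mul_sum]
      _ ≤ B ^ 2 * A := by gcongr; exact hA T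
      _ = _ := mul_comm _ _
  have hS : Summable fun q : Z d × Z d => |Riesz d α q.1 q.2 * a q.2 * b q.1| :=
    summable_of_sum_le (fun q => abs_nonneg _) hT
  have hS' : Summable fun q : Z d × Z d => Riesz d α q.1 q.2 * a q.2 * b q.1 := hS.of_abs
  refine ⟨hS', ?_⟩
  have e : (∑' x : Z d, conv d α a x * b x) =
      ∑' q : Z d × Z d, Riesz d α q.1 q.2 * a q.2 * b q.1 := by
    rw [hS'.tsum_prod]
    refine tsum_congr fun x => ?_
    rw [conv, ← tsum_mul_right]
  rw [e]
  exact (hS'.tsum_le_tsum (fun q => le_abs_self _) hS).trans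
    (Real.tsum_le_of_sum_le (fun q => abs_nonneg _) hT)

theorem weight_bound {g : ℝ → ℝ} {p τ ε C : ℝ} (hp : 0 < p) (hτ : 0 < τ) (hε : 0 < ε) (hC : 0 < C)
    (hg0 : g 0 = 0) (hg : ∀ v : ℝ, 0 ≤ v → g v ≤ ε * v ^ p + C * v ^ τ)
    {v : Z d → ℝ} (hv : ∀ x, 0 ≤ v x) (hs : Summable fun x => v x ^ p) :
    ∃ w : Z d → ℝ, (∀ x, 0 ≤ w x) ∧ (∀ S : Finset (Z d), ∑ x ∈ S, w x ≤ 1) ∧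
      ∀ x, g (v x) ≤ (ε * (∑' x, v x ^ p) + C * (∑' x, v x ^ p) ^ (τ / p)) *
        w x ^ (min 1 (τ / p)) := by
  set U := ∑' x, v x ^ p with hU
  have hvp : ∀ x, 0 ≤ v x ^ p := fun x => Real.rpow_nonneg (hv x) _
  have hU0 : 0 ≤ U := tsum_nonneg hvp
  have hle : ∀ x, v x ^ p ≤ U := fun x => hs.le_tsum x fun y _ => hvp y
  have hγ0 : 0 < min 1 (τ / p) := lt_min one_pos (div_pos hτ hp)
  refine ⟨fun x => v x ^ p / U, fun x => div_nonneg (hvp x) hU0, fun S => ?_, fun x => ?_⟩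
  · rw [← Finset.sum_div]
    exact div_le_one_of_le₀ (hs.sum_le_tsum S fun y _ => hvp y) hU0
  · rcases hU0.eq_or_lt with h0 | hUpos
    · have h1 : v x ^ p = 0 := le_antisymm ((hle x).trans h0.symm.le) (hvp x)
      have h2 : v x = 0 := ((Real.rpow_eq_zero (hv x) hp.ne').1 h1)
      rw [h2, hg0]
      have := Real.rpow_nonneg hU0 (τ / p)
      have h3 : 0 ≤ (v x ^ p / U) ^ (min 1 (τ / p)) := Real.rpow_nonneg (div_nonneg (hvp x) hU0) _
      rw [h2] at h3
      positivity
    · set W := v x ^ p / U with hW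
      have hW0 : 0 ≤ W := div_nonneg (hvp x) hU0
      have hW1 : W ≤ 1 := div_le_one_of_le₀ (hle x) hU0
      have e1 : v x ^ p = U * W := by rw [hW]; field_simp
      have e2 : v x ^ τ = U ^ (τ / p) * W ^ (τ / p) := by
        rw [← Real.mul_rpow hU0 hW0, ← e1, ← Real.rpow_mul (hv x)]
        congr 1; field_simp
      have l1 : W ≤ W ^ (min 1 (τ / p)) := by
        calc W = W ^ (1 : ℝ) := (Real.rpow_one W).symm
          _ ≤ _ := Real.rpow_le_rpow_of_exponent_ge' hW0 hW1 hγ0.le (min_le_left _ _)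
      have l2 : W ^ (τ / p) ≤ W ^ (min 1 (τ / p)) :=
        Real.rpow_le_rpow_of_exponent_ge' hW0 hW1 hγ0.le (min_le_right _ _)
      have hUr := Real.rpow_nonneg hU0 (τ / p)
      calc g (v x) ≤ ε * v x ^ p + C * v x ^ τ := hg _ (hv x)
        _ = ε * U * W + C * U ^ (τ / p) * W ^ (τ / p) := by rw [e1, e2]; ring
        _ ≤ ε * U * W ^ (min 1 (τ / p)) + C * U ^ (τ / p) * W ^ (min 1 (τ / p)) := by gcongr
        _ = _ := by ring

theorem final_arith {A ε h₀ C U X r : ℝ} (hA : 0 < A) (hε : 0 < ε) (hh : 0 < h₀)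
    (hU : 0 ≤ U) (hX : U ≤ X / h₀) (hX0 : 0 ≤ X) (hr : 0 ≤ r) :
    A * (h₀ * √(ε / (2 * A)) * U + C * U ^ r) ^ 2 ≤
      ε * X ^ 2 + (2 * A * C ^ 2 * ((h₀ ^ r)⁻¹) ^ 2) * (X ^ r) ^ 2 := by
  have s : √(ε / (2 * A)) ^ 2 = ε / (2 * A) := Real.sq_sqrt (by positivity)
  have h1 : (h₀ * U) ^ 2 ≤ X ^ 2 := by
    have : h₀ * U ≤ X := by rw [le_div_iff₀ hh] at hX; linarith
    gcongr
  have h2 : U ^ r ≤ (h₀ ^ r)⁻¹ * X ^ r := by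
    refine (Real.rpow_le_rpow hU hX hr).trans (le_of_eq ?_)
    rw [Real.div_rpow hX0 hh.le]; field_simp
  have h3 : (U ^ r) ^ 2 ≤ ((h₀ ^ r)⁻¹ * X ^ r) ^ 2 := by
    have := Real.rpow_nonneg hU r
    gcongr
  calc A * (h₀ * √(ε / (2 * A)) * U + C * U ^ r) ^ 2
      ≤ A * (2 * (h₀ * √(ε / (2 * A)) * U) ^ 2 + 2 * (C * U ^ r) ^ 2) := by
        gcongr
        nlinarith [sq_nonneg (h₀ * √(ε / (2 * A)) * U - C * U ^ r)]
    _ = (2 * A * √(ε / (2 * A)) ^ 2) * (h₀ * U) ^ 2 + 2 * A * C ^ 2 * (U ^ r) ^ 2 := by ring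
    _ = ε * (h₀ * U) ^ 2 + 2 * A * C ^ 2 * (U ^ r) ^ 2 := by
        rw [s]; congr 2; field_simp
    _ ≤ ε * X ^ 2 + 2 * A * C ^ 2 * ((h₀ ^ r)⁻¹ * X ^ r) ^ 2 := by gcongr
    _ = _ := by ring

theorem choquard_term_norm_estimate
    {d : ℕ} (hd : 0 < d) {s p : ℝ} (hs : s ∈ Set.Ioo (0 : ℝ) 1) (hp : 2 ≤ p)
    {W : Z d → Z d → ℝ} (hW : KernelOK d s W)
    {α : ℝ} (hα : α ∈ Set.Ioo (0 : ℝ) (d : ℝ))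
    {h : Z d → ℝ} {h₀ : ℝ} (hh₀ : 0 < h₀) (hh1 : ∀ x, h₀ ≤ h x)
    {f : ℝ → ℝ} (hfc : Continuous f) (hfz : ∀ t ≤ (0 : ℝ), f t = 0)
    (hf1 : F1 f p)
    {C₀ τ : ℝ} (hC₀ : 0 < C₀) (hτ : ((d : ℝ) + α) * p / (2 * d) < τ)
    (hf2 : ∀ t > (0 : ℝ), f t ≤ C₀ * (1 + t ^ (τ - 1)))
    {θ : ℝ} (hθ : p < θ) (hf3 : F3 f θ)
 :
    ∀ ε > (0 : ℝ), ∃ Cε : ℝ, 0 < Cε ∧ ∀ u : Z d → ℝ, memH W h p u →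
      (Summable fun q : Z d × Z d =>
        Riesz d α q.1 q.2 * Fint f (pos u q.2) * Fint f (pos u q.1)) ∧
      (Summable fun q : Z d × Z d =>
        Riesz d α q.1 q.2 * Fint f (pos u q.2) * (f (pos u q.1) * pos u q.1)) ∧
      (∑' x : Z d, conv d α (fun y => Fint f (pos u y)) x * Fint f (pos u x)) ≤
        ε * normH W h p u ^ (2 * p) + Cε * normH W h p u ^ (2 * τ) ∧
      (∑' x : Z d, conv d α (fun y => Fint f (pos u y)) x * f (pos u x) * pos u x) ≤
        ε * normH W h p u ^ (2 * p) + Cε * normH W h p u ^ (2 * τ) := by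
  intro ε hε
  have hd0 : (0 : ℝ) < d := by exact_mod_cast hd
  have hp0 : 0 < p := by linarith
  have hτp : p / 2 < τ := by
    refine lt_of_le_of_lt ?_ hτ
    rw [div_le_div_iff₀ (by norm_num) (by positivity)]
    nlinarith [mul_pos hα.1 hp0]
  have hτ1 : 1 < τ := by linarith
  have hγ : ((d : ℝ) + α) / (2 * d) < min 1 (τ / p) := by
    refine lt_min ?_ ?_
    · rw [div_lt_one (by positivity)]; linarith [hα.2]
    · rw [lt_div_iff₀ hp0]
      calc ((d : ℝ) + α) / (2 * d) * p = ((d : ℝ) + α) * p / (2 * d) := by ring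
        _ < τ := hτ
  obtain ⟨A, hA0, hA⟩ := form_bound hd hα hγ (min_le_left _ _)
  have hε' : 0 < h₀ * √(ε / (2 * A)) := by positivity
  obtain ⟨C, hC, hg⟩ := g_bound hf1 hC₀ hτ1.le hf2 hε'
  refine ⟨2 * A * C ^ 2 * ((h₀ ^ (τ / p))⁻¹) ^ 2, by positivity, fun u hu => ?_⟩
  have hv : ∀ x, 0 ≤ pos u x := fun x => le_max_right _ _
  have hvu : ∀ x, pos u x ≤ |u x| := fun x => max_le (le_abs_self _) (abs_nonneg _)
  have hterm : ∀ x, h₀ * pos u x ^ p ≤ gradNorm W u x ^ p + h x * |u x| ^ p := by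
    intro x
    have h1 : pos u x ^ p ≤ |u x| ^ p := Real.rpow_le_rpow (hv x) (hvu x) hp0.le
    have h2 : 0 ≤ gradNorm W u x ^ p := Real.rpow_nonneg (Real.sqrt_nonneg _) _
    have h3 : h₀ * pos u x ^ p ≤ h x * |u x| ^ p :=
      mul_le_mul (hh1 x) h1 (Real.rpow_nonneg (hv x) _) (hh₀.le.trans (hh1 x))
    linarith
  have hsum0 : Summable fun x => h₀ * pos u x ^ p :=
    Summable.of_nonneg_of_le (fun x => mul_nonneg hh₀.le (Real.rpow_nonneg (hv x) _)) hterm hu.2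
  have hsum : Summable fun x => pos u x ^ p := (summable_mul_left_iff hh₀.ne').1 hsum0
  have hUX : (∑' x, pos u x ^ p) ≤ HnormP W h p u / h₀ := by
    rw [le_div_iff₀ hh₀, mul_comm, ← tsum_mul_left]
    exact hsum0.tsum_le_tsum hterm hu.2
  have hU0 : 0 ≤ ∑' x, pos u x ^ p := tsum_nonneg fun x => Real.rpow_nonneg (hv x) _
  have hX0 : 0 ≤ HnormP W h p u := by
    have := hU0.trans hUX
    rw [le_div_iff₀ hh₀] at this
    linarith
  obtain ⟨w, hw0, hw1, hgw⟩ := weight_bound (g := fun v => f v * v) hp0 (by linarith) hε' hC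
    (by simp) hg hv hsum
  have hF0 : Fint f 0 = 0 := by simp [Fint]
  have hFpos : ∀ v, 0 ≤ v → 0 ≤ Fint f v := by
    intro v hv
    rcases hv.eq_or_lt with rfl | hv
    · rw [hF0]
    · exact nonneg_of_mul_nonneg_right (hf3 v hv).1 (by linarith)
  have hFle : ∀ v, 0 ≤ v → Fint f v ≤ f v * v := by
    intro v hv
    rcases hv.eq_or_lt with rfl | hv'
    · rw [hF0]; simp
    · have h1 := (hf3 v hv').2
      have h2 := hFpos v hv
      nlinarith
  have hB0 : 0 ≤ h₀ * √(ε / (2 * A)) * (∑' x, pos u x ^ p) + C * (∑' x, pos u x ^ p) ^ (τ / p) := by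
    have := Real.rpow_nonneg hU0 (τ / p)
    positivity
  have a0 : ∀ x, 0 ≤ Fint f (pos u x) := fun x => hFpos _ (hv x)
  have a1 := fun x => (hFle _ (hv x)).trans (hgw x)
  have b0 : ∀ x, 0 ≤ f (pos u x) * pos u x := fun x => (a0 x).trans (hFle _ (hv x))
  obtain ⟨S1, T1⟩ := conv_bound (hA w hw0 hw1) hB0 hw0 a0 a1 a0 a1
  obtain ⟨S2, T2⟩ := conv_bound (hA w hw0 hw1) hB0 hw0 a0 a1 b0 hgw
  have hfin := final_arith (C := C) (r := τ / p) hA0 hε hh₀ hU0 hUX hX0 (by positivity)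
  have n1 : normH W h p u ^ (2 * p) = HnormP W h p u ^ 2 := by
    rw [normH, ← Real.rpow_mul hX0, ← Real.rpow_natCast]
    congr 1; field_simp; norm_num
  have n2 : normH W h p u ^ (2 * τ) = (HnormP W h p u ^ (τ / p)) ^ 2 := by
    rw [normH, ← Real.rpow_mul hX0, ← Real.rpow_natCast, ← Real.rpow_mul hX0]
    congr 1; push_cast; field_simp
  rw [n1, n2]
  refine ⟨S1, S2, T1.trans hfin, ?_⟩
  simp_rw [mul_assoc]
  simp_rw [mul_assoc] at T2 hfin
  exact T2.trans hfin

end DiscreteChoquard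
end
end

section
/- (Integration by parts.) Suppose u : ℤ^d → ℝ is bounded and satisfies ∑_{x∈ℤ^d}(|∇^s u|^p(x) + |u(x)|^p) < ∞. Then for every x ∈ ℤ^d the series defining (−Δ)_p^s u(x) converges absolutely, and for every finitely supported φ : ℤ^d → ℝ one has ∑_{x∈ℤ^d} φ(x)·(−Δ)_p^s u(x) = ∑_{x∈ℤ^d} |∇^s u|^{p−2}(x)·∇^s u∇^s φ(x), the series on the right also converging absolutely. -/
open MeasureTheory Filter Topology
open scoped ENNReal

noncomputable section

namespace DiscreteChoquard

variable {d : ℕ}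

/-- Membership of integer points in the standard lattice. -/
lemma intPoint_mem (z : Z d) : (fun i => (z i : ℝ)) ∈
    Submodule.span ℤ (Set.range (Pi.basisFun ℝ (Fin d))) := by
  have h : (fun i => (z i : ℝ)) = ∑ i, z i • (Pi.basisFun ℝ (Fin d)) i := by
    ext j
    simp [Finset.sum_apply, Pi.single_apply]
  rw [h]
  exact Submodule.sum_mem _ fun i _ =>
    Submodule.smul_mem _ _ (Submodule.subset_span ⟨i, rfl⟩)

lemma summable_norm_point {r : ℝ} (hr : r < -(d : ℝ)) (x : Z d) :
    Summable fun y : Z d => ‖fun i => ((y i : ℝ) - (x i : ℝ))‖ ^ r := by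
  let L := Submodule.span ℤ (Set.range (Pi.basisFun ℝ (Fin d)))
  have hfr : Module.finrank ℤ L = d := by
    rw [ZLattice.rank ℝ L]; simp
  have h := ZLattice.summable_norm_sub_rpow L r (by rw [hfr]; exact hr) (fun i => (x i : ℝ))
  let e : Z d → L := fun z => ⟨fun i => (z i : ℝ), intPoint_mem z⟩
  have he : Function.Injective e := by
    intro a b hab
    have h1 := congrArg Subtype.val hab
    funext i
    have h2 : (a i : ℝ) = (b i : ℝ) := congrFun h1 i
    exact_mod_cast h2
  have hc := h.comp_injective he
  refine hc.congr fun y => ?_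
  have hy : ((e y : L) : Fin d → ℝ) - (fun i => (x i : ℝ)) = fun i => ((y i : ℝ) - (x i : ℝ)) := rfl
  rw [Function.comp_apply, hy]

lemma norm_le_latDist (x y : Z d) :
    ‖fun i => ((y i : ℝ) - (x i : ℝ))‖ ≤ latDist x y := by
  have hnn : ∀ i ∈ Finset.univ, 0 ≤ |((x i - y i : ℤ) : ℝ)| := fun i _ => abs_nonneg _
  refine (pi_norm_le_iff_of_nonneg (Finset.sum_nonneg hnn)).2 fun i => ?_
  refine le_trans ?_ (Finset.single_le_sum hnn (Finset.mem_univ i))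
  rw [Real.norm_eq_abs, abs_sub_comm]
  push_cast
  exact le_rfl

lemma kernel_summable {s : ℝ} (hs : 0 < s) {W : Z d → Z d → ℝ} (hW : KernelOK d s W) (x : Z d) :
    Summable (W x) := by
  obtain ⟨-, hpos, c, C, hc, hcC, hb⟩ := hW
  have h1 := (summable_norm_point (r := -(d : ℝ) - 2 * s) (by linarith) x).mul_left C
  have h2 : Summable fun y : Z d => if y = x then W x x else 0 :=
    (hasSum_ite_eq x (W x x)).summable
  refine Summable.of_nonneg_of_le (fun y => (hpos x y).le) (fun y => ?_) (h1.add h2)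
  by_cases hxy : y = x
  · subst hxy
    have : 0 ≤ C * ‖fun i => ((y i : ℝ) - (y i : ℝ))‖ ^ (-(d : ℝ) - 2 * s) :=
      mul_nonneg (hc.le.trans hcC) (Real.rpow_nonneg (norm_nonneg _) _)
    simp only [if_true]
    linarith
  · simp only [if_neg hxy, add_zero]
    refine ((hb x y (Ne.symm hxy)).2).trans ?_
    refine mul_le_mul_of_nonneg_left ?_ (hc.le.trans hcC)
    refine Real.rpow_le_rpow_of_nonpos ?_ (norm_le_latDist x y) ?_
    · rw [norm_pos_iff]
      intro h0
      apply hxy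
      funext i
      have h2 := congrFun h0 i
      simp only [Pi.zero_apply, sub_eq_zero] at h2
      exact_mod_cast h2
    · have : (0 : ℝ) ≤ d := Nat.cast_nonneg d
      linarith

lemma summable_prod_of_support {φ : Z d → ℝ} (hφ : (Function.support φ).Finite)
    {h : Z d → Z d → ℝ} (hh : ∀ x, Summable (h x)) :
    Summable fun q : Z d × Z d => φ q.1 * h q.1 q.2 := by
  rw [← summable_abs_iff, summable_prod_of_nonneg (fun _ => abs_nonneg _)]
  refine ⟨fun x => ((hh x).mul_left (φ x)).abs, ?_⟩
  refine summable_of_finite_support (hφ.subset fun x hx => ?_)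
  intro h0
  apply hx
  simp [h0]

lemma gradNorm_bdd {p : ℝ} (hp : 2 ≤ p) {W : Z d → Z d → ℝ} {u : Z d → ℝ}
    (hsum : Summable fun x : Z d => gradNorm W u x ^ p + |u x| ^ p) :
    ∃ K : ℝ, ∀ x, gradNorm W u x ^ (p - 2) ≤ K := by
  have hg : ∀ x, 0 ≤ gradNorm W u x := fun x => Real.sqrt_nonneg _
  have hnn : ∀ x, 0 ≤ gradNorm W u x ^ p + |u x| ^ p := fun x =>
    add_nonneg (Real.rpow_nonneg (hg x) _) (Real.rpow_nonneg (abs_nonneg _) _)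
  refine ⟨1 + ∑' x, (gradNorm W u x ^ p + |u x| ^ p), fun x => ?_⟩
  have h1 : gradNorm W u x ^ p + |u x| ^ p ≤ ∑' x, (gradNorm W u x ^ p + |u x| ^ p) :=
    hsum.le_tsum x fun j _ => hnn j
  have h2 : 0 ≤ |u x| ^ p := Real.rpow_nonneg (abs_nonneg _) _
  have h4 : 0 ≤ gradNorm W u x ^ p := Real.rpow_nonneg (hg x) _
  rcases le_total (gradNorm W u x) 1 with h | h
  · have h3 := Real.rpow_le_one (hg x) h (by linarith : 0 ≤ p - 2)
    linarith
  · have h3 := Real.rpow_le_rpow_of_exponent_le h (by linarith : p - 2 ≤ p)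
    linarith

theorem integration_by_parts
    {d : ℕ} (hd : 0 < d) {s p : ℝ} (hs : s ∈ Set.Ioo (0 : ℝ) 1) (hp : 2 ≤ p)
    {W : Z d → Z d → ℝ} (hW : KernelOK d s W)
    (u : Z d → ℝ) (hub : ∃ M : ℝ, ∀ x, |u x| ≤ M)
    (hgrad : ∀ x : Z d, Summable fun y : Z d => W x y * (u x - u y) ^ 2)
    (hsum : Summable fun x : Z d => gradNorm W u x ^ p + |u x| ^ p) :
    (∀ x : Z d,
      Summable fun y : Z d =>
        W x y * (gradNorm W u x ^ (p - 2) + gradNorm W u y ^ (p - 2)) * (u x - u y)) ∧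
    ∀ φ : Z d → ℝ, (Function.support φ).Finite →
      (Summable fun x : Z d => gradNorm W u x ^ (p - 2) * gradForm W u φ x) ∧
      ∑' x : Z d, φ x * pLap W p u x =
        ∑' x : Z d, gradNorm W u x ^ (p - 2) * gradForm W u φ x := by
  obtain ⟨M, hM⟩ := hub
  obtain ⟨K, hK⟩ := gradNorm_bdd hp hsum
  have hWs := kernel_summable hs.1 hW
  have hsymm := hW.1
  have hpos := hW.2.1
  have hG0 : ∀ x, 0 ≤ gradNorm W u x ^ (p - 2) := fun x =>
    Real.rpow_nonneg (Real.sqrt_nonneg _) _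
  set G : Z d → ℝ := fun x => gradNorm W u x ^ (p - 2) with hG
  have hu : ∀ x y, |u x - u y| ≤ 2 * M := fun x y => by
    have := abs_sub (u x) (u y)
    have := hM x
    have := hM y
    linarith
  -- generic summability
  have key : ∀ (x : Z d) (H : Z d → ℝ), (∀ y, 0 ≤ H y) → (∀ y, H y ≤ K) →
      Summable fun y => W x y * H y * (u x - u y) := by
    intro x H h0 h1
    refine Summable.of_norm_bounded ((hWs x).mul_right (K * (2 * M))) fun y => ?_
    rw [Real.norm_eq_abs, abs_mul, abs_mul, abs_of_pos (hpos x y), abs_of_nonneg (h0 y), mul_assoc]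
    exact mul_le_mul_of_nonneg_left
      (mul_le_mul (h1 y) (hu x y) (abs_nonneg _) ((h0 y).trans (h1 y))) (hpos x y).le
  have sA : ∀ x, Summable fun y => W x y * G x * (u x - u y) := fun x =>
    key x (fun _ => G x) (fun _ => hG0 x) (fun _ => hK x)
  have sB : ∀ x, Summable fun y => W x y * G y * (u x - u y) := fun x => key x G hG0 hK
  refine ⟨fun x => ((sA x).add (sB x)).congr fun y => by simp only [hG]; ring, fun φ hφ => ?_⟩
  have pA := summable_prod_of_support hφ sA
  have pB := summable_prod_of_support hφ sB
  have pB' : Summable fun q : Z d × Z d => φ q.2 * (W q.2 q.1 * G q.1 * (u q.2 - u q.1)) :=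
    pB.comp_injective Prod.swap_injective
  have pF := pA.add pB'
  have e1 : ∀ x, gradNorm W u x ^ (p - 2) * gradForm W u φ x = (1 / 2) * ∑' y,
      (φ x * (W x y * G x * (u x - u y)) + φ y * (W y x * G x * (u y - u x))) := by
    intro x
    rw [gradForm, mul_left_comm, ← tsum_mul_left]
    congr 1
    refine tsum_congr fun y => ?_
    rw [hsymm y x]
    simp only [hG]
    ring
  have e2 : ∀ x, φ x * pLap W p u x = (1 / 2) * ∑' y,
      (φ x * (W x y * G x * (u x - u y)) + φ x * (W x y * G y * (u x - u y))) := by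
    intro x
    rw [pLap, mul_left_comm, ← tsum_mul_left]
    congr 1
    refine tsum_congr fun y => ?_
    simp only [hG]
    ring
  refine ⟨?_, ?_⟩
  · exact (pF.prod.mul_left (1 / 2)).congr fun x => (e1 x).symm
  · rw [tsum_congr e1, tsum_congr e2, tsum_mul_left, tsum_mul_left]
    congr 1
    have t1 := pF.tsum_prod
    have t2 := (pA.add pB).tsum_prod
    rw [← t1, ← t2, pA.tsum_add pB, pA.tsum_add pB']
    congr 1
    exact ((Equiv.prodComm (Z d) (Z d)).tsum_eq
      (fun q : Z d × Z d => φ q.1 * (W q.1 q.2 * G q.2 * (u q.1 - u q.2)))).symm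


end DiscreteChoquard
end
end
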